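/- arXiv:2401.17119 — 2 statements merged into one kernel-verified Lean document; each statement's English description precedes it below -/
import Mathlib

section
/- A one-dimensional shift X is an isolated point of the space S^1 if and only if X has the no-middle-cycle property, i.e. there exists n ≥ 1 such that the directed graph G_{X,n} contains no middle cycle. -/
/-- The group `ℤ^d`. -/
abbrev ZD (d : ℕ) := Fin d → ℤ

/-- A configuration is a map `ℤ^d → ℤ`. -/
abbrev Config (d : ℕ) := ZD d → ℤ

/-- The shift map `σ^u`, defined by `σ^u(x)_v = x_{u+v}`. -/
def shiftMap {d : ℕ} (u : ZD d) (x : Config d) : Config d := fun v => x (u + v)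

/-- The sup norm `‖·‖_∞` on `ℤ^d`, valued in `ℕ`. -/
def normInf {d : ℕ} (n : ZD d) : ℕ := Finset.univ.sup fun i => (n i).natAbs

open Classical in
/-- The metric `δ` on configurations: `δ(x,y) = 2^{-min{‖n‖_∞ : x_n ≠ y_n}}`, `δ(x,x) = 0`. -/
noncomputable def deltaDist {d : ℕ} (x y : Config d) : ℝ :=
  if x = y then 0
  else (2 : ℝ) ^ (-((sInf {m : ℕ | ∃ n : ZD d, normInf n = m ∧ x n ≠ y n} : ℕ) : ℤ))

/-- The closure of a set of configurations with respect to the metric `δ`. -/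
def deltaClosure {d : ℕ} (A : Set (Config d)) : Set (Config d) :=
  {x | ∀ ε : ℝ, 0 < ε → ∃ a ∈ A, deltaDist x a < ε}

/-- A set of configurations is closed for `δ` when it contains all its limit points. -/
def IsDeltaClosed {d : ℕ} (A : Set (Config d)) : Prop := deltaClosure A ⊆ A

/-- A `d`-dimensional shift: a nonempty set of configurations over a common finite
alphabet, closed for `δ` and invariant under every shift map. -/
def IsShift {d : ℕ} (X : Set (Config d)) : Prop :=
  X.Nonempty ∧ (∃ A : Finset ℤ, ∀ x ∈ X, ∀ v : ZD d, x v ∈ A) ∧ IsDeltaClosed X ∧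
    ∀ u : ZD d, ∀ x ∈ X, shiftMap u x ∈ X

/-- The Hausdorff metric `δ_H` on the space of shifts. -/
noncomputable def deltaH {d : ℕ} (X Z : Set (Config d)) : ℝ :=
  max (⨆ x : X, ⨅ z : Z, deltaDist (x : Config d) (z : Config d))
      (⨆ z : Z, ⨅ x : X, deltaDist (x : Config d) (z : Config d))

/-- A subsystem of a shift `X`: a nonempty closed shift-invariant subset of `X`. -/
def IsSubsystem {d : ℕ} (Z X : Set (Config d)) : Prop :=
  Z.Nonempty ∧ Z ⊆ X ∧ IsDeltaClosed Z ∧ ∀ u : ZD d, ∀ z ∈ Z, shiftMap u z ∈ Z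

/-- A maximal subsystem of `X`: a proper subsystem such that any subsystem strictly
between it and `X` equals `X`. -/
def IsMaximalSubsystem {d : ℕ} (Z X : Set (Config d)) : Prop :=
  IsSubsystem Z X ∧ Z ≠ X ∧ ∀ Z', IsSubsystem Z' X → Z ⊂ Z' → Z' = X

/-- An outcast of `X`: a proper subsystem contained in no maximal subsystem of `X`. -/
def IsOutcast {d : ℕ} (Z X : Set (Config d)) : Prop :=
  IsSubsystem Z X ∧ Z ≠ X ∧ ∀ M, IsMaximalSubsystem M X → ¬ Z ⊆ M

/-- A pattern with finite support `U` (given by the values of `p` on `U`) appears in the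
configuration `x`. -/
def PatternAppears {d : ℕ} (U : Finset (ZD d)) (p : ZD d → ℤ) (x : Config d) : Prop :=
  ∃ u : ZD d, ∀ v ∈ U, x (u + v) = p v

/-- The set of configurations over the alphabet `A` avoiding every pattern in `F`. -/
def XofF {d : ℕ} (A : Finset ℤ) (F : Set (Finset (ZD d) × (ZD d → ℤ))) : Set (Config d) :=
  {x | (∀ v : ZD d, x v ∈ A) ∧ ∀ q ∈ F, ¬ PatternAppears q.1 q.2 x}

/-- A shift of finite type: defined by a finite alphabet and a finite set of forbidden
patterns. -/
def IsSFT {d : ℕ} (X : Set (Config d)) : Prop :=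
  ∃ (A : Finset ℤ) (F : Finset (Finset (ZD d) × (ZD d → ℤ))), X = XofF A (F : Set _)

/-- `X` is an isolated point of the subspace `S` (with the Hausdorff metric `δ_H`). -/
def IsolatedIn {d : ℕ} (S : Set (Set (Config d))) (X : Set (Config d)) : Prop :=
  X ∈ S ∧ ∃ ε : ℝ, 0 < ε ∧ ∀ Z ∈ S, deltaH X Z < ε → Z = X

/-- The orbit of a configuration under the shift action. -/
def orbit {d : ℕ} (x : Config d) : Set (Config d) := {y | ∃ u : ZD d, y = shiftMap u x}

/-- A shift is transitive when some point has dense orbit. -/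
def IsTransitive {d : ℕ} (X : Set (Config d)) : Prop :=
  IsShift X ∧ ∃ x ∈ X, X ⊆ deltaClosure (orbit x)

/-- A shift is minimal when its only subsystem is itself. -/
def IsMinimalShift {d : ℕ} (X : Set (Config d)) : Prop :=
  IsShift X ∧ ∀ Z, IsSubsystem Z X → Z = X

/-- A word `w` of length `n` belongs to the language `L_n(X)` of a one-dimensional
shift `X`. -/
def wordIn (X : Set (Config 1)) (n : ℕ) (w : Fin n → ℤ) : Prop :=
  ∃ x ∈ X, ∃ u : ZD 1, ∀ i : Fin n, x (u + fun _ => (i : ℤ)) = w i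

/-- The edge relation of the graph `G_{X,n}`: there is an edge from `w` to `w'`
(both length-`n` words of the language) when some word of `L_{n+1}(X)` has `w` as
prefix and `w'` as suffix. -/
def graphEdge (X : Set (Config 1)) (n : ℕ) (w w' : Fin n → ℤ) : Prop :=
  wordIn X n w ∧ wordIn X n w' ∧
  ∃ v : Fin (n + 1) → ℤ, wordIn X (n + 1) v ∧
    (∀ i : Fin n, v i.castSucc = w i) ∧ (∀ i : Fin n, v i.succ = w' i)

/-- The graph `G_{X,n}` contains a middle cycle: a closed directed walk having both an
incoming edge from a vertex not on it and an outgoing edge to a vertex not on it. -/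
def HasMiddleCycle (X : Set (Config 1)) (n : ℕ) : Prop :=
  ∃ k : ℕ, 1 ≤ k ∧ ∃ c : ℕ → (Fin n → ℤ),
    (∀ i < k, graphEdge X n (c i) (c (i + 1))) ∧ c k = c 0 ∧
    (∃ w : Fin n → ℤ, wordIn X n w ∧ (∀ i < k, c i ≠ w) ∧
      ∃ i < k, graphEdge X n w (c i)) ∧
    (∃ w : Fin n → ℤ, wordIn X n w ∧ (∀ i < k, c i ≠ w) ∧
      ∃ i < k, graphEdge X n (c i) w)

namespace NMC

open Relation

variable {V : Type*}

/-- Bi-infinite walks. -/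
def BiWalk (E : V → V → Prop) (x : ℤ → V) : Prop := ∀ i, E (x i) (x (i + 1))

/-- Finite walk of length `k`. -/
def FinWalk (E : V → V → Prop) (k : ℕ) (c : ℕ → V) : Prop := ∀ i < k, E (c i) (c (i + 1))

/-- Middle cycle in an abstract graph. -/
def Mid (E : V → V → Prop) : Prop :=
  ∃ k : ℕ, 1 ≤ k ∧ ∃ c : ℕ → V, FinWalk E k c ∧ c k = c 0 ∧
    (∃ w, (∀ i < k, c i ≠ w) ∧ ∃ i < k, E w (c i)) ∧
    (∃ w, (∀ i < k, c i ≠ w) ∧ ∃ i < k, E (c i) w)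

theorem mid_swap {E : V → V → Prop} (h : Mid (Function.swap E)) : Mid E := by
  obtain ⟨k, hk, c, hc, hck, ⟨w, hw, i, hi, hwi⟩, ⟨w', hw', i', hi', hwi'⟩⟩ := h
  have key : ∀ i < k, ∃ j < k, c (k - j) = c i := by
    intro i hi
    rcases Nat.eq_zero_or_pos i with h0 | h0
    · exact ⟨0, hk, by simp [h0, hck]⟩
    · exact ⟨k - i, by omega, by congr 1; omega⟩
  have key2 : ∀ j < k, ∃ i < k, c i = c (k - j) := by
    intro j hj
    rcases Nat.eq_zero_or_pos j with h0 | h0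
    · exact ⟨0, hk, by simp [h0, hck]⟩
    · exact ⟨k - j, by omega, rfl⟩
  refine ⟨k, hk, fun j => c (k - j), ?_, by simp [hck], ⟨w', ?_, ?_⟩, ⟨w, ?_, ?_⟩⟩
  · intro j hj
    have := hc (k - (j + 1)) (by omega)
    rw [show k - (j + 1) + 1 = k - j by omega] at this
    exact this
  · intro j hj
    obtain ⟨i, hi, h⟩ := key2 j hj
    simpa [h] using hw' i hi
  · obtain ⟨j, hj, h⟩ := key i' hi'
    exact ⟨j, hj, by simpa [h] using hwi'⟩
  · intro j hj
    obtain ⟨i, hi, h⟩ := key2 j hj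
    simpa [h] using hw i hi
  · obtain ⟨j, hj, h⟩ := key i hi
    exact ⟨j, hj, by simpa [h] using hwi⟩

theorem exit_edge {E : V → V → Prop} {a b : V} (h : TransGen E a b) (P : V → Prop)
    (ha : P a) (hb : ¬ P b) : ∃ p q, E p q ∧ P p ∧ ¬ P q := by
  induction h with
  | single h => exact ⟨_, _, h, ha, hb⟩
  | @tail b c h1 h2 ih =>
    by_cases hP : P b
    · exact ⟨_, _, h2, hP, hb⟩
    · exact ih hP

theorem finWalk_trans {E : V → V → Prop} {k : ℕ} {c : ℕ → V} (hc : FinWalk E k c)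
    {i j : ℕ} (hij : i < j) (hj : j ≤ k) : TransGen E (c i) (c j) := by
  induction j, hij using Nat.le_induction with
  | base => exact TransGen.single (hc i (by omega))
  | succ j hij ih => exact (ih (by omega)).tail (hc j (by omega))

theorem exists_finWalk {E : V → V → Prop} {a b : V} (h : TransGen E a b) :
    ∃ k, 1 ≤ k ∧ ∃ c : ℕ → V, FinWalk E k c ∧ c 0 = a ∧ c k = b := by
  induction h with
  | @single b h =>
    refine ⟨1, le_rfl, fun i => if i = 0 then a else b, ?_, by simp, by simp⟩
    intro i hi
    obtain rfl : i = 0 := by omega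
    simpa using h
  | @tail b d h1 h2 ih =>
    obtain ⟨k, hk, c, hc, h0, hk'⟩ := ih
    refine ⟨k + 1, by omega, fun i => if i ≤ k then c i else d, ?_, by simp [h0], by simp⟩
    intro i hi
    rcases Nat.lt_or_ge i k with h | h
    · have h3 : i ≤ k := by omega
      have h4 : i + 1 ≤ k := by omega
      simpa [h3, h4] using hc i h
    · obtain rfl : i = k := by omega
      simpa [hk'] using h2

theorem cycle_covers {E : V → V → Prop} (hE : ¬ Mid E) {k : ℕ} (hk : 1 ≤ k) {c : ℕ → V}
    (hc : FinWalk E k c) (hck : c k = c 0) {u : V} (h1 : TransGen E (c 0) u)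
    (h2 : TransGen E u (c 0)) : ∃ i < k, c i = u := by
  by_contra hu
  apply hE
  have h0 : ∃ i < k, c i = c 0 := ⟨0, hk, rfl⟩
  obtain ⟨p, q, hpq, hp, hq⟩ := exit_edge h1 (fun v => ∃ i < k, c i = v) h0 hu
  obtain ⟨p', q', hpq', hp', hq'⟩ :=
    exit_edge h2 (fun v => ¬ ∃ i < k, c i = v) hu (not_not.mpr h0)
  obtain ⟨i, hi, rfl⟩ := hp
  obtain ⟨i', hi', rfl⟩ := not_not.mp hq'
  push Not at hq hp'
  exact ⟨k, hk, c, hc, hck, ⟨p', hp', i', hi', hpq'⟩, ⟨q, hq, i, hi, hpq⟩⟩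

theorem succ_unique {E : V → V → Prop} (hE : ¬ Mid E) {v a b : V}
    (ha : E v a) (ha' : TransGen E a v) (hb : E v b) (hb' : TransGen E b v) : a = b := by
  classical
  have hex : ∃ k, 1 ≤ k ∧ ∃ c : ℕ → V, FinWalk E k c ∧ c 0 = v ∧ c k = v :=
    exists_finWalk (TransGen.head ha ha')
  obtain ⟨hk, c, hc, h0, hk'⟩ := Nat.find_spec hex
  have hmin := fun m (hm : m < Nat.find hex) => Nat.find_min hex hm
  generalize Nat.find hex = k at *
  have key : ∀ a, E v a → TransGen E a v → a = c 1 := by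
    intro a ha ha'
    have : ∃ j, 1 ≤ j ∧ j ≤ k ∧ c j = a := by
      obtain ⟨i, hi, h⟩ := cycle_covers hE hk hc (hk'.trans h0.symm) (u := a)
        (by rw [h0]; exact TransGen.single ha) (by rw [h0]; exact ha')
      rcases Nat.eq_zero_or_pos i with hi0 | hi0
      · exact ⟨k, hk, le_rfl, by rw [hk', ← h0, ← hi0, h]⟩
      · exact ⟨i, hi0, hi.le, h⟩
    obtain ⟨j, hj1, hjk, rfl⟩ := this
    by_contra hne
    have hj : j ≠ 1 := by rintro rfl; exact hne rfl
    refine hmin (k - j + 1) (by omega) ⟨by omega, fun i => if i = 0 then v else c (j + i - 1),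
      ?_, by simp, ?_⟩
    · intro i hi
      rcases Nat.eq_zero_or_pos i with hi0 | hi0
      · simpa [hi0] using ha
      · have h3 : i ≠ 0 := by omega
        have := hc (j + i - 1) (by omega)
        rw [show j + i - 1 + 1 = j + (i + 1) - 1 by omega] at this
        simpa [h3] using this
    · simp only [Nat.add_eq_zero_iff, one_ne_zero, and_false, if_false]
      rw [show j + (k - j + 1) - 1 = k by omega, hk']
  exact (key a ha ha').trans (key b hb hb').symm

/-- no edge leaves the strongly connected class of `v`. -/
def SinkAt (E : V → V → Prop) (v : V) : Prop :=
  ∀ u w, TransGen E v u → TransGen E u v → E u w → TransGen E w v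

theorem sink_or_source {E : V → V → Prop} (hE : ¬ Mid E) {v : V} (hv : TransGen E v v) :
    SinkAt E v ∨ SinkAt (Function.swap E) v := by
  by_contra hcon
  rw [not_or] at hcon
  obtain ⟨h1, h2⟩ := hcon
  unfold SinkAt at h1 h2
  push Not at h1 h2
  simp only [transGen_swap] at h2
  obtain ⟨u, w, hvu, huv, huw, hwv⟩ := h1
  obtain ⟨u', w', hvu', huv', huw', hwv'⟩ := h2
  obtain ⟨k, hk, c, hc, rfl, hk'⟩ := exists_finWalk hv
  obtain ⟨i, hi, rfl⟩ := cycle_covers hE hk hc hk' hvu huv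
  obtain ⟨i', hi', rfl⟩ := cycle_covers hE hk hc hk' huv' hvu'
  refine hE ⟨k, hk, c, hc, hk', ⟨w', ?_, i', hi', huw'⟩, ⟨w, ?_, i, hi, huw⟩⟩
  · rintro j hj rfl
    rcases Nat.eq_zero_or_pos j with hj0 | hj0
    · subst hj0; exact hwv' hv
    · exact hwv' (finWalk_trans hc hj0 hj.le)
  · rintro j hj rfl
    have := finWalk_trans hc hj le_rfl
    rw [hk'] at this
    exact hwv this

theorem biWalk_trans {E : V → V → Prop} {x : ℤ → V} (hx : BiWalk E x)
    {i j : ℤ} (hij : i < j) : TransGen E (x i) (x j) := by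
  induction j, (show i + 1 ≤ j from hij) using Int.leInduction with
  | base => exact TransGen.single (hx i)
  | succ j hij ih => exact (ih (by omega)).tail (hx j)

theorem biWalk_rev {E : V → V → Prop} {x : ℤ → V} (hx : BiWalk E x) :
    BiWalk (Function.swap E) (fun i => x (-i)) := by
  intro i
  have := hx (-(i + 1))
  rw [show -(i + 1) + 1 = -i by ring] at this
  exact this

theorem sink_stay {E : V → V → Prop} {x : ℤ → V} (hx : BiWalk E x)
    {a : ℤ} (ha : TransGen E (x a) (x a)) (hs : SinkAt E (x a)) {j : ℤ} (hj : a ≤ j) :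
    TransGen E (x j) (x a) := by
  induction j, hj using Int.leInduction with
  | base => exact ha
  | succ j hij ih =>
    refine hs (x j) _ ?_ ih (hx j)
    rcases hij.eq_or_lt with h | h
    · rw [← h]; exact ha
    · exact biWalk_trans hx h

theorem sink_det {E : V → V → Prop} (hE : ¬ Mid E) {x z : ℤ → V} (hx : BiWalk E x)
    (hz : BiWalk E z) {a : ℤ} (hax : z a = x a)
    (ha : TransGen E (x a) (x a)) (hs : SinkAt E (x a)) {j : ℤ} (hj : a ≤ j) :
    z j = x j := by
  induction j, hj using Int.leInduction with
  | base => exact hax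
  | succ j hij ih =>
    have h1 := sink_stay hx ha hs (show a ≤ j + 1 by omega)
    have h2 := sink_stay hz (a := a) (by rw [hax]; exact ha) (by rw [hax]; exact hs)
      (show a ≤ j + 1 by omega)
    have h3 : TransGen E (x a) (x j) := by
      rcases hij.eq_or_lt with h | h
      · rw [← h]; exact ha
      · exact biWalk_trans hx h
    rw [hax] at h2
    have h4 := hz j
    rw [ih] at h4
    exact succ_unique hE h4 (h2.trans h3) (hx j) (h1.trans h3)

theorem source_det {E : V → V → Prop} (hE : ¬ Mid E) {x z : ℤ → V} (hx : BiWalk E x)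
    (hz : BiWalk E z) {a : ℤ} (hax : z a = x a)
    (ha : TransGen E (x a) (x a)) (hs : SinkAt (Function.swap E) (x a)) {j : ℤ} (hj : j ≤ a) :
    z j = x j := by
  have := sink_det (E := Function.swap E) (fun h => hE (mid_swap h)) (biWalk_rev hx)
    (biWalk_rev hz) (a := -a) (by simpa using hax) (by simpa [transGen_swap] using ha)
    (by simpa using hs) (j := -j) (by omega)
  simpa using this

theorem source_stay {E : V → V → Prop} {x : ℤ → V} (hx : BiWalk E x)
    {a : ℤ} (ha : TransGen E (x a) (x a)) (hs : SinkAt (Function.swap E) (x a)) {j : ℤ}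
    (hj : j ≤ a) : TransGen E (x a) (x j) := by
  have := sink_stay (biWalk_rev hx) (a := -a) (by simpa [transGen_swap] using ha)
    (by simpa using hs) (j := -j) (by omega)
  simpa [transGen_swap] using this

theorem exists_repeat {x : ℤ → V} {S : Finset V} (hS : ∀ i, x i ∈ S) (t : ℤ) :
    ∃ i j, t ≤ i ∧ i < j ∧ j ≤ t + S.card ∧ x i = x j := by
  obtain ⟨i, hi, j, hj, hne, h⟩ := Finset.exists_ne_map_eq_of_card_lt_of_maps_to
    (s := Finset.range (S.card + 1)) (t := S) (f := fun i : ℕ => x (t + i)) (by simp)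
    (fun i _ => hS _)
  simp only [Finset.mem_range] at hi hj
  rcases lt_or_gt_of_ne hne with h' | h'
  · exact ⟨t + i, t + j, by omega, by omega, by omega, h⟩
  · exact ⟨t + j, t + i, by omega, by omega, by omega, h.symm⟩

theorem exists_recurrent {E : V → V → Prop} {x : ℤ → V} (hx : BiWalk E x)
    {S : Finset V} (hS : ∀ i, x i ∈ S) (t : ℤ) :
    ∃ i, t ≤ i ∧ i ≤ t + S.card ∧ TransGen E (x i) (x i) := by
  obtain ⟨i, j, h1, h2, h3, h4⟩ := exists_repeat hS t
  refine ⟨i, h1, by omega, ?_⟩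
  have := biWalk_trans hx h2
  rwa [← h4] at this

theorem rigid {E : V → V → Prop} (hE : ¬ Mid E) {x : ℤ → V} (hx : BiWalk E x)
    {S : Finset V} (hS : ∀ i, x i ∈ S) :
    ∃ t : ℤ, ∀ z, BiWalk E z → (∀ i, t - (S.card + 1) ≤ i → i ≤ t + (S.card + 1) → z i = x i) →
      ∀ k : ℕ, ∃ s : ℤ, ∀ j : ℤ, |j| ≤ k → z (s + j) = x j := by
  by_cases hA : ∀ i, TransGen E (x (i + 1)) (x i)
  · have hrev : BiWalk (Function.swap E) (fun i => x (-i)) := biWalk_rev hx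
    have hback : ∀ i j, i < j → TransGen E (x j) (x i) := by
      intro i j hij
      induction j, (show i + 1 ≤ j from hij) using Int.leInduction with
      | base => exact hA i
      | succ j hij ih => exact (hA j).trans (ih (by omega))
    have hall : ∀ i j, TransGen E (x i) (x j) := by
      intro i j
      rcases lt_trichotomy i j with h | h | h
      · exact biWalk_trans hx h
      · subst h; exact (biWalk_trans hx (show i < i + 1 by omega)).trans (hA i)
      · exact hback _ _ h
    obtain ⟨a, b, -, hab, -, hxab⟩ := exists_repeat hS 0
    have hper : ∀ j, x (j + (b - a)) = x j := by
      intro j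
      rcases le_total a j with h | h
      · induction j, h using Int.leInduction with
        | base => rw [hxab]; congr 1; ring
        | succ j hj ih =>
          have h1 := hx (j + (b - a))
          rw [ih] at h1
          rw [show j + 1 + (b - a) = j + (b - a) + 1 by ring]
          exact succ_unique hE h1 (hall _ _) (hx j) (hall _ _)
      · induction j, h using Int.leInductionDown with
        | base => rw [hxab]; congr 1; ring
        | pred j hj ih =>
          have h1 := hx (j - 1 + (b - a))
          rw [show j - 1 + (b - a) + 1 = j + (b - a) by ring, ih] at h1
          have h2 := hx (j - 1)
          rw [show j - 1 + 1 = j by ring] at h2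
          exact succ_unique (E := Function.swap E) (fun h => hE (mid_swap h)) h1
            (by rw [transGen_swap]; exact hall _ _) h2 (by rw [transGen_swap]; exact hall _ _)
    have hP : Function.Periodic x (b - a) := hper
    refine ⟨0, fun z hz hzx k => ?_⟩
    have hz0 : z 0 = x 0 := hzx 0 (by omega) (by omega)
    have hpk : (k : ℤ) ≤ k * (b - a) := le_mul_of_one_le_right (by omega) (by omega)
    rcases sink_or_source hE (hall 0 0) with h | h
    · refine ⟨k * (b - a), fun j hj => ?_⟩
      rw [abs_le] at hj
      rw [sink_det hE hx hz hz0 (hall 0 0) h (by omega), add_comm]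
      exact_mod_cast hP.int_mul k j
    · refine ⟨(-k : ℤ) * (b - a), fun j hj => ?_⟩
      rw [abs_le] at hj
      rw [source_det hE hx hz hz0 (hall 0 0) h (by rw [neg_mul]; omega), add_comm]
      exact_mod_cast hP.int_mul (-k) j
  · push Not at hA
    obtain ⟨i, hi⟩ := hA
    refine ⟨i, fun z hz hzx k => ⟨0, fun j _ => ?_⟩⟩
    obtain ⟨a, ha1, ha2, ha⟩ := exists_recurrent hx hS (i - S.card)
    obtain ⟨b, hb1, hb2, hb⟩ := exists_recurrent hx hS (i + 1)
    have hsa : SinkAt (Function.swap E) (x a) := by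
      refine (sink_or_source hE ha).resolve_left fun h => hi ?_
      have h1 := sink_stay hx ha h (show a ≤ i + 1 by omega)
      rcases (show a ≤ i by omega).eq_or_lt with h | h
      · rwa [h] at h1
      · exact h1.trans (biWalk_trans hx h)
    have hsb : SinkAt E (x b) := by
      refine (sink_or_source hE hb).resolve_right fun h => hi ?_
      have h1 := source_stay hx hb h (show i ≤ b by omega)
      rcases (show i + 1 ≤ b by omega).eq_or_lt with h | h
      · rwa [← h] at h1
      · exact (biWalk_trans hx h).trans h1
    rw [zero_add]
    rcases le_total j a with h | h
    · exact source_det hE hx hz (hzx a (by omega) (by omega)) ha hsa h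
    rcases le_total b j with h' | h'
    · exact sink_det hE hx hz (hzx b (by omega) (by omega)) hb hsb h'
    exact hzx j (by omega) (by omega)

theorem glue {E : V → V → Prop} {x y : ℤ → V} (hx : BiWalk E x) (hy : BiWalk E y) {a b : ℤ}
    (h : x a = y b) : ∃ z, BiWalk E z ∧ (∀ i ≤ a, z i = x i) ∧
      ∀ i, a ≤ i → z i = y (i - a + b) := by
  refine ⟨fun i => if i ≤ a then x i else y (i - a + b), ?_, ?_, ?_⟩
  · intro i
    rcases lt_trichotomy i a with h1 | h1 | h1
    · have h2 : i ≤ a := by omega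
      have h3 : i + 1 ≤ a := by omega
      simpa [h2, h3] using hx i
    · subst h1
      have := hy b
      rw [← h] at this
      simpa [add_comm] using this
    · have h2 : ¬ i ≤ a := by omega
      have h3 : ¬ i + 1 ≤ a := by omega
      have := hy (i - a + b)
      rw [show i - a + b + 1 = i + 1 - a + b by ring] at this
      simpa [h2, h3] using this
  · intro i hi; simp [hi]
  · intro i hi
    rcases hi.eq_or_lt with h1 | h1
    · subst h1; simp [h]
    · have h2 : ¬ i ≤ a := by omega
      simp [h2]

theorem fix_right {E : V → V → Prop} {x l : ℤ → V} (hx : BiWalk E x) (hl : BiWalk E l) (t : ℤ) :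
    ∃ z, BiWalk E z ∧ (∀ i ≤ t, z i = x i) ∧
      ∀ i j, t ≤ i → i ≤ j → z i ∈ Set.range l → z j ∈ Set.range l := by
  classical
  by_cases hex : ∃ d : ℕ, x (t + d) ∈ Set.range l
  · obtain ⟨b, hb⟩ := Nat.find_spec hex
    have hmin := fun m (hm : m < Nat.find hex) => Nat.find_min hex hm
    generalize Nat.find hex = d at *
    obtain ⟨z, hz, hzx, hzl⟩ := glue hx hl hb.symm
    refine ⟨z, hz, fun i hi => hzx i (by omega), fun i j hti hij hi => ?_⟩
    rcases le_total (t + d) j with h | h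
    · exact ⟨_, (hzl j h).symm⟩
    rcases (show i ≤ t + d by omega).eq_or_lt with h' | h'
    · obtain rfl : j = i := by omega
      exact hi
    · exfalso
      refine hmin (i - t).toNat (by omega) ?_
      rw [show t + ((i - t).toNat : ℤ) = i by omega, ← hzx i (by omega)]
      exact hi
  · refine ⟨x, hx, fun _ _ => rfl, fun i j hti hij hi => ?_⟩
    exfalso
    refine hex ⟨(i - t).toNat, ?_⟩
    rwa [show t + ((i - t).toNat : ℤ) = i by omega]

theorem fix_left {E : V → V → Prop} {x l : ℤ → V} (hx : BiWalk E x) (hl : BiWalk E l) (t : ℤ) :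
    ∃ z, BiWalk E z ∧ (∀ i, t ≤ i → z i = x i) ∧
      ∀ i j, i ≤ t → j ≤ i → z i ∈ Set.range l → z j ∈ Set.range l := by
  obtain ⟨z, hz, h1, h2⟩ := fix_right (biWalk_rev hx) (biWalk_rev hl) (-t)
  have hr : Set.range (fun i => l (-i)) = Set.range l :=
    (Equiv.neg ℤ).surjective.range_comp l
  rw [hr] at h2
  refine ⟨fun i => z (-i), biWalk_rev hz, fun i hi => ?_, fun i j hi hj h => ?_⟩
  · have := h1 (-i) (by omega)
    simpa using this
  · exact h2 (-i) (-j) (by omega) (by omega) h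

theorem edge_walk {E : V → V → Prop} {x l : ℤ → V} (hx : BiWalk E x) (hl : BiWalk E l) :
    ∃ z, BiWalk E z ∧ z 0 = x 0 ∧ z 1 = x 1 ∧
      ∀ s t e, s < t → t < e → z t ∈ Set.range l → z s ∈ Set.range l ∨ z e ∈ Set.range l := by
  obtain ⟨y, hy, h1, h2⟩ := fix_right hx hl 1
  obtain ⟨z, hz, h3, h4⟩ := fix_left hy hl 0
  refine ⟨z, hz, ?_, ?_, ?_⟩
  · rw [h3 0 le_rfl, h1 0 (by norm_num)]
  · rw [h3 1 (by norm_num), h1 1 le_rfl]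
  · intro s t e hst hte ht
    rcases le_or_gt t 0 with h | h
    · exact Or.inl (h4 t s h hst.le ht)
    · right
      rw [h3 t (by omega)] at ht
      rw [h3 e (by omega)]
      exact h2 t e (by omega) hte.le ht

theorem loop_walk {E : V → V → Prop} {k : ℕ} (hk : 1 ≤ k) {c : ℕ → V} (hc : FinWalk E k c)
    (hck : c k = c 0) : ∃ l : ℤ → V, BiWalk E l ∧ (∀ v, v ∈ Set.range l ↔ ∃ i < k, c i = v) ∧
      ∀ i m : ℤ, ∃ j, m ≤ j ∧ l j = l i := by
  have hk0 : (0 : ℤ) < k := by omega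
  refine ⟨fun i => c (i % k).toNat, ?_, ?_, ?_⟩
  · intro i
    have h0 := Int.emod_nonneg i hk0.ne'
    have h1 := Int.emod_lt_of_pos i hk0
    have h2 := hc (i % k).toNat (by omega)
    have h3 : (i + 1) % k = (i % k + 1) % k := by simp
    by_cases h : i % k + 1 = k
    · have h4 : (i % k).toNat + 1 = k := by omega
      rw [h4, hck] at h2
      simpa [h3, h] using h2
    · have h5 : (i + 1) % (k : ℤ) = i % k + 1 := by
        rw [h3]; exact Int.emod_eq_of_lt (by omega) (by omega)
      have h4 : (i % k).toNat + 1 = ((i + 1) % (k : ℤ)).toNat := by omega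
      rw [h4] at h2
      exact h2
  · intro v
    constructor
    · rintro ⟨i, rfl⟩
      have h0 := Int.emod_nonneg i hk0.ne'
      have h1 := Int.emod_lt_of_pos i hk0
      exact ⟨_, by omega, rfl⟩
    · rintro ⟨i, hi, rfl⟩
      refine ⟨i, ?_⟩
      simp only
      congr 1
      rw [Int.emod_eq_of_lt (by omega) (by omega)]
      simp
  · intro i m
    refine ⟨i + (|m| + |i|) * k, ?_, by simp⟩
    have h1 : |m| + |i| ≤ (|m| + |i|) * k := le_mul_of_one_le_right (by positivity) (by omega)
    have := le_abs_self m
    have := neg_abs_le i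
    omega

theorem through_walk {E : V → V → Prop} (hext : ∀ a b, E a b → ∃ x, BiWalk E x ∧ x 0 = a ∧ x 1 = b)
    {l : ℤ → V} (hl : BiWalk E l) (hrec : ∀ i m : ℤ, ∃ j, m ≤ j ∧ l j = l i) {p q : V} {i j : ℤ}
    (hp : E p (l i)) (hq : E (l j) q) : ∃ z, BiWalk E z ∧ z 0 = p ∧ z 1 = l i ∧ ∃ m, 1 < m ∧ z m = q := by
  obtain ⟨x, hx, hx0, hx1⟩ := hext _ _ hp
  obtain ⟨y, hy, hy0, hy1⟩ := hext _ _ hq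
  obtain ⟨u, hu, hux, hul⟩ := glue hx hl hx1
  obtain ⟨j', hj', hlj⟩ := hrec j i
  have h1 := hul (1 + (j' - i)) (by omega)
  rw [show 1 + (j' - i) - 1 + i = j' by ring, hlj, ← hy0] at h1
  obtain ⟨z, hz, hzu, hzy⟩ := glue hu hy h1
  refine ⟨z, hz, ?_, ?_, 1 + (j' - i) + 1, by omega, ?_⟩
  · rw [hzu 0 (by omega), hux 0 (by omega), hx0]
  · rw [hzu 1 (by omega), hux 1 (by omega), hx1]
  · rw [hzy _ (by omega), ← hy1]; congr 1; ring

end NMC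

namespace NMC

/-- The walk of `n`-blocks of a configuration. -/
def blk (n : ℕ) (x : Config 1) : ℤ → (Fin n → ℤ) := fun i j => x (fun _ => i + (j : ℤ))

theorem zd_eq (u : ZD 1) : u = fun _ => u 0 := by
  funext i
  rw [Subsingleton.elim i 0]

theorem wordIn_iff {X : Set (Config 1)} {n : ℕ} {w : Fin n → ℤ} :
    wordIn X n w ↔ ∃ x ∈ X, ∃ i : ℤ, blk n x i = w := by
  constructor
  · rintro ⟨x, hx, u, h⟩
    refine ⟨x, hx, u 0, funext fun j => ?_⟩
    rw [← h j, zd_eq u]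
    rfl
  · rintro ⟨x, hx, i, rfl⟩
    exact ⟨x, hx, fun _ => i, fun j => rfl⟩

theorem graphEdge_iff {X : Set (Config 1)} {n : ℕ} {w w' : Fin n → ℤ} :
    graphEdge X n w w' ↔ ∃ x ∈ X, ∃ i : ℤ, blk n x i = w ∧ blk n x (i + 1) = w' := by
  constructor
  · rintro ⟨-, -, v, hv, h1, h2⟩
    obtain ⟨x, hx, i, rfl⟩ := wordIn_iff.mp hv
    refine ⟨x, hx, i, funext fun j => ?_, funext fun j => ?_⟩
    · rw [← h1 j]; simp [blk]
    · rw [← h2 j]; simp only [blk, Fin.val_succ]; congr 1; funext _; push_cast; ring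
  · rintro ⟨x, hx, i, rfl, rfl⟩
    refine ⟨wordIn_iff.mpr ⟨x, hx, i, rfl⟩, wordIn_iff.mpr ⟨x, hx, i + 1, rfl⟩, blk (n + 1) x i,
      wordIn_iff.mpr ⟨x, hx, i, rfl⟩, fun j => by simp [blk], fun j => ?_⟩
    simp only [blk, Fin.val_succ]; congr 1; funext _; push_cast; ring

theorem hasMiddleCycle_iff {X : Set (Config 1)} {n : ℕ} :
    HasMiddleCycle X n ↔ Mid (graphEdge X n) := by
  constructor
  · rintro ⟨k, hk, c, hc, hck, ⟨w, -, hw⟩, ⟨w', -, hw'⟩⟩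
    exact ⟨k, hk, c, hc, hck, ⟨w, hw⟩, ⟨w', hw'⟩⟩
  · rintro ⟨k, hk, c, hc, hck, ⟨w, hw, i, hi, h⟩, ⟨w', hw', i', hi', h'⟩⟩
    exact ⟨k, hk, c, hc, hck, ⟨w, h.1, hw, i, hi, h⟩, ⟨w', h'.2.1, hw', i', hi', h'⟩⟩

theorem edge_overlap {X : Set (Config 1)} {n : ℕ} {w w' : Fin n → ℤ} (h : graphEdge X n w w')
    (j : ℕ) (hj : j + 1 < n) : w ⟨j + 1, hj⟩ = w' ⟨j, by omega⟩ := by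
  obtain ⟨x, hx, i, rfl, rfl⟩ := graphEdge_iff.mp h
  simp only [blk]; congr 1; funext _; push_cast; ring

theorem of_walk {X : Set (Config 1)} {n : ℕ} (hn : 1 ≤ n) {z : ℤ → (Fin n → ℤ)}
    (hz : BiWalk (graphEdge X n) z) : ∃ y : Config 1, blk n y = z := by
  refine ⟨fun v => z (v 0) ⟨0, hn⟩, ?_⟩
  have key : ∀ (j : ℕ) (hj : j < n) (i : ℤ), z (i + j) ⟨0, hn⟩ = z i ⟨j, hj⟩ := by
    intro j
    induction j with
    | zero => intro hj i; simp
    | succ j ih =>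
      intro hj i
      rw [edge_overlap (hz i) j hj, ← ih (by omega)]
      push_cast
      rw [show i + ((j : ℤ) + 1) = i + 1 + j by ring]
  funext i j
  exact key j j.2 i

/-- `x` and `z` agree on the window of radius `R` around `t`. -/
def Agr (R : ℕ) (t : ℤ) (x z : Config 1) : Prop :=
  ∀ i : ℤ, |i - t| ≤ R → z (fun _ => i) = x (fun _ => i)

theorem normInf_one (v : ZD 1) : normInf v = (v 0).natAbs := by
  simp [normInf]

theorem dist_le {R : ℕ} {x z : Config 1} (h : Agr R 0 x z) :
    deltaDist x z ≤ (1 / 2 : ℝ) ^ (R + 1) := by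
  unfold deltaDist
  split_ifs with hxz
  · positivity
  · set S := {m : ℕ | ∃ n : ZD 1, normInf n = m ∧ x n ≠ z n} with hS
    have hne : S.Nonempty := by
      obtain ⟨v, hv⟩ := Function.ne_iff.mp hxz
      exact ⟨_, v, rfl, hv⟩
    obtain ⟨v, hv, hxv⟩ := Nat.sInf_mem hne
    have hR : R + 1 ≤ sInf S := by
      by_contra hlt
      apply hxv
      rw [zd_eq v]
      refine (h (v 0) ?_).symm
      rw [normInf_one] at hv
      rw [sub_zero, Int.abs_eq_natAbs]
      omega
    rw [zpow_neg, zpow_natCast, ← inv_pow, ← one_div]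
    exact pow_le_pow_of_le_one (by norm_num) (by norm_num) hR

theorem agr_of_dist {R : ℕ} {x z : Config 1} (h : deltaDist x z < (1 / 2 : ℝ) ^ R) :
    Agr R 0 x z := by
  intro i hi
  by_contra hne
  unfold deltaDist at h
  have hxz : x ≠ z := by rintro rfl; exact hne rfl
  rw [if_neg hxz] at h
  have hle : sInf {m : ℕ | ∃ n : ZD 1, normInf n = m ∧ x n ≠ z n} ≤ i.natAbs :=
    Nat.sInf_le ⟨fun _ => i, normInf_one _, fun h => hne h.symm⟩
  rw [zpow_neg, zpow_natCast, ← inv_pow, ← one_div] at h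
  have h2 := (pow_lt_pow_iff_right_of_lt_one₀ (by norm_num) (by norm_num)).mp h
  rw [sub_zero, Int.abs_eq_natAbs] at hi
  omega

theorem exists_R {ε : ℝ} (hε : 0 < ε) : ∃ R : ℕ, (1 / 2 : ℝ) ^ R < ε :=
  exists_pow_lt_of_lt_one hε (by norm_num)

theorem dist_lt_of_agr {R : ℕ} {x z : Config 1} (h : Agr R 0 x z) :
    deltaDist x z < (1 / 2 : ℝ) ^ R :=
  (dist_le h).trans_lt (pow_lt_pow_right_of_lt_one₀ (by norm_num) (by norm_num) (by omega))

theorem mem_closure_iff' {A : Set (Config 1)} {x : Config 1} :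
    x ∈ deltaClosure A ↔ ∀ R : ℕ, ∃ a ∈ A, Agr R 0 x a := by
  constructor
  · intro h R
    obtain ⟨a, ha, h⟩ := h ((1 / 2 : ℝ) ^ R) (by positivity)
    exact ⟨a, ha, agr_of_dist h⟩
  · intro h ε hε
    obtain ⟨R, hR⟩ := exists_R hε
    obtain ⟨a, ha, h⟩ := h R
    exact ⟨a, ha, (dist_lt_of_agr h).trans hR⟩

theorem dist_nonneg' (x z : Config 1) : 0 ≤ deltaDist x z := by
  unfold deltaDist; split_ifs <;> positivity

theorem dist_le_one (x z : Config 1) : deltaDist x z ≤ 1 := by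
  unfold deltaDist
  split_ifs
  · norm_num
  · rw [zpow_neg, zpow_natCast, ← inv_pow]
    exact pow_le_one₀ (by norm_num) (by norm_num)

theorem sup_inf_lt {P Q : Set (Config 1)} (hQ : Q.Nonempty) (f : Config 1 → Config 1 → ℝ)
    (h0 : ∀ a b, 0 ≤ f a b) (h1 : ∀ a b, f a b ≤ 1) {ε : ℝ}
    (h : (⨆ x : P, ⨅ z : Q, f x z) < ε) : ∀ x ∈ P, ∃ z ∈ Q, f x z < ε := by
  intro x hx
  have : Nonempty Q := hQ.to_subtype
  have hbdd : ∀ x : P, BddBelow (Set.range fun z : Q => f x z) :=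
    fun x => ⟨0, by rintro _ ⟨z, rfl⟩; exact h0 _ _⟩
  have hb : BddAbove (Set.range fun x : P => ⨅ z : Q, f x z) := by
    refine ⟨1, ?_⟩
    rintro _ ⟨y, rfl⟩
    exact (ciInf_le (hbdd y) (Classical.arbitrary Q)).trans (h1 _ _)
  have h2 := (le_ciSup hb ⟨x, hx⟩).trans_lt h
  obtain ⟨z, hz⟩ := exists_lt_of_ciInf_lt h2
  exact ⟨z, z.2, hz⟩

theorem sup_inf_le {P Q : Set (Config 1)} (hP : P.Nonempty) (f : Config 1 → Config 1 → ℝ)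
    (h0 : ∀ a b, 0 ≤ f a b) {ε : ℝ}
    (h : ∀ x ∈ P, ∃ z ∈ Q, f x z ≤ ε) : (⨆ x : P, ⨅ z : Q, f x z) ≤ ε := by
  have : Nonempty P := hP.to_subtype
  refine ciSup_le fun x => ?_
  obtain ⟨z, hz, hxz⟩ := h x x.2
  exact (ciInf_le ⟨0, by rintro _ ⟨z, rfl⟩; exact h0 _ _⟩ ⟨z, hz⟩).trans hxz

theorem agr_symm {R : ℕ} {t : ℤ} {x z : Config 1} (h : Agr R t x z) : Agr R t z x :=
  fun i hi => (h i hi).symm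

theorem agr_of_deltaH {X Z : Set (Config 1)} (hX : X.Nonempty) (hZ : Z.Nonempty) {R : ℕ}
    (h : deltaH X Z < (1 / 2 : ℝ) ^ R) :
    (∀ x ∈ X, ∃ z ∈ Z, Agr R 0 x z) ∧ (∀ z ∈ Z, ∃ x ∈ X, Agr R 0 z x) := by
  obtain ⟨h1, h2⟩ := max_lt_iff.mp h
  constructor
  · intro x hx
    obtain ⟨z, hz, h⟩ := sup_inf_lt hZ deltaDist dist_nonneg' dist_le_one h1 x hx
    exact ⟨z, hz, agr_of_dist h⟩
  · intro z hz
    obtain ⟨x, hx, h⟩ := sup_inf_lt hX (fun z x => deltaDist x z) (fun a b => dist_nonneg' b a)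
      (fun a b => dist_le_one b a) h2 z hz
    exact ⟨x, hx, agr_symm (agr_of_dist h)⟩

theorem deltaH_lt {X Z : Set (Config 1)} (hX : X.Nonempty) (hZ : Z.Nonempty) {R : ℕ}
    (h1 : ∀ x ∈ X, ∃ z ∈ Z, Agr R 0 x z) (h2 : ∀ z ∈ Z, ∃ x ∈ X, Agr R 0 z x) :
    deltaH X Z < (1 / 2 : ℝ) ^ R := by
  refine lt_of_le_of_lt (b := (1 / 2 : ℝ) ^ (R + 1)) (max_le ?_ ?_)
    (pow_lt_pow_right_of_lt_one₀ (by norm_num) (by norm_num) (by omega))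
  · refine sup_inf_le hX deltaDist dist_nonneg' fun x hx => ?_
    obtain ⟨z, hz, h⟩ := h1 x hx
    exact ⟨z, hz, dist_le h⟩
  · refine sup_inf_le hZ (fun z x => deltaDist x z) (fun a b => dist_nonneg' b a) fun z hz => ?_
    obtain ⟨x, hx, h⟩ := h2 z hz
    exact ⟨x, hx, dist_le (agr_symm h)⟩

theorem shift_apply (t i : ℤ) (x : Config 1) :
    shiftMap (fun _ => t) x (fun _ => i) = x (fun _ => t + i) := rfl

theorem agr_shift {P Q : Set (Config 1)} (hP : ∀ u : ZD 1, ∀ x ∈ P, shiftMap u x ∈ P)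
    (hQ : ∀ u : ZD 1, ∀ x ∈ Q, shiftMap u x ∈ Q) {R : ℕ}
    (h : ∀ x ∈ P, ∃ z ∈ Q, Agr R 0 x z) (t : ℤ) : ∀ x ∈ P, ∃ z ∈ Q, Agr R t x z := by
  intro x hx
  obtain ⟨z, hz, hxz⟩ := h _ (hP (fun _ => t) x hx)
  refine ⟨_, hQ (fun _ => -t) z hz, fun i hi => ?_⟩
  rw [shift_apply, hxz _ (by rwa [show -t + i - 0 = i - t by ring]), shift_apply]
  congr 1; funext _; ring

theorem blk_agr {n R : ℕ} {t i : ℤ} {x z : Config 1} (h : Agr R t x z) (h1 : t - R ≤ i)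
    (h2 : i + n ≤ t + R + 1) : blk n z i = blk n x i := by
  funext j
  refine h _ ?_
  have := j.2
  rw [abs_le]
  constructor <;> omega

theorem sub_of_rigid {X P Q : Set (Config 1)} {n : ℕ} (hn : 1 ≤ n)
    (hE : ¬ Mid (graphEdge X n)) {S : Finset (Fin n → ℤ)} (hS : ∀ w, wordIn X n w → w ∈ S)
    (hPw : ∀ x ∈ P, BiWalk (graphEdge X n) (blk n x))
    (hQw : ∀ x ∈ Q, BiWalk (graphEdge X n) (blk n x))
    (hPQ : ∀ t : ℤ, ∀ x ∈ P, ∃ z ∈ Q, Agr (S.card + 1 + n) t x z)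
    (hQc : IsDeltaClosed Q) (hQs : ∀ u : ZD 1, ∀ x ∈ Q, shiftMap u x ∈ Q) : P ⊆ Q := by
  intro x hx
  obtain ⟨t, ht⟩ := rigid hE (hPw x hx) (S := S) (fun i => hS _ (hPw x hx i).1)
  obtain ⟨z, hz, hxz⟩ := hPQ t x hx
  have hk := ht (blk n z) (hQw z hz) (fun i h1 h2 => blk_agr hxz (by push_cast; omega)
    (by push_cast; omega))
  refine hQc (mem_closure_iff'.mpr fun R => ?_)
  obtain ⟨s, hs⟩ := hk R
  refine ⟨_, hQs (fun _ => s) z hz, fun i hi => ?_⟩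
  have := congrFun (hs i (by simpa using hi)) ⟨0, hn⟩
  simpa [blk, shift_apply] using this

theorem walk_of_mem {X : Set (Config 1)} {x : Config 1} (hx : x ∈ X) (n : ℕ) :
    BiWalk (graphEdge X n) (blk n x) :=
  fun i => graphEdge_iff.mpr ⟨x, hx, i, rfl, rfl⟩

theorem isolated_of_no_mid {X : Set (Config 1)} (hX : IsShift X) {n : ℕ} (hn : 1 ≤ n)
    (hE : ¬ Mid (graphEdge X n)) : IsolatedIn {Y : Set (Config 1) | IsShift Y} X := by
  refine ⟨hX, ?_⟩
  obtain ⟨hne, ⟨A, hA⟩, hcl, hsh⟩ := hX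
  let S : Finset (Fin n → ℤ) := Fintype.piFinset fun _ => A
  have hS : ∀ w, wordIn X n w → w ∈ S := by
    intro w hw
    obtain ⟨x, hx, i, rfl⟩ := wordIn_iff.mp hw
    exact Fintype.mem_piFinset.mpr fun j => hA x hx _
  refine ⟨(1 / 2 : ℝ) ^ (S.card + 1 + n), by positivity, ?_⟩
  rintro Z ⟨hZne, -, hZcl, hZsh⟩ hXZ
  obtain ⟨h1, h2⟩ := agr_of_deltaH hne hZne hXZ
  have h1 := agr_shift hsh hZsh h1
  have h2 := agr_shift hZsh hsh h2
  have hXw : ∀ x ∈ X, BiWalk (graphEdge X n) (blk n x) := fun x hx => walk_of_mem hx n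
  have hZw : ∀ z ∈ Z, BiWalk (graphEdge X n) (blk n z) := by
    intro z hz i
    obtain ⟨x, hx, hzx⟩ := h2 i z hz
    refine graphEdge_iff.mpr ⟨x, hx, i, blk_agr hzx ?_ ?_, blk_agr hzx ?_ ?_⟩ <;> push_cast <;> omega
  exact Set.Subset.antisymm (sub_of_rigid hn hE hS hZw hXw h2 hcl hsh)
    (sub_of_rigid hn hE hS hXw hZw h1 hZcl hZsh)

/-- Walks in the graph that never enter and later leave `C`. -/
def ZC (X : Set (Config 1)) (n : ℕ) (C : Set (Fin n → ℤ)) : Set (Config 1) :=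
  {y | BiWalk (graphEdge X n) (blk n y) ∧
    ∀ s t e, s < t → t < e → blk n y t ∈ C → blk n y s ∈ C ∨ blk n y e ∈ C}

theorem blk_shift (n : ℕ) (u : ZD 1) (y : Config 1) (i : ℤ) :
    blk n (shiftMap u y) i = blk n y (u 0 + i) := by
  funext j
  rw [zd_eq u]
  simp only [blk, shift_apply]
  congr 1; funext _; ring

theorem ZC_shift {X : Set (Config 1)} {n : ℕ} {C : Set (Fin n → ℤ)} (u : ZD 1) {y : Config 1}
    (hy : y ∈ ZC X n C) : shiftMap u y ∈ ZC X n C := by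
  refine ⟨fun i => ?_, fun s t e hst hte ht => ?_⟩
  · rw [blk_shift, blk_shift, ← add_assoc]; exact hy.1 _
  · rw [blk_shift] at ht ⊢
    rw [blk_shift]
    exact hy.2 _ (u 0 + t) _ (by omega) (by omega) ht

theorem ZC_closed {X : Set (Config 1)} {n : ℕ} {C : Set (Fin n → ℤ)} :
    IsDeltaClosed (ZC X n C) := by
  intro y hy
  rw [mem_closure_iff'] at hy
  refine ⟨fun i => ?_, fun s t e hst hte ht => ?_⟩
  · obtain ⟨a, ha, h⟩ := hy (i.natAbs + n + 1)
    have := ha.1 i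
    rwa [blk_agr h (by omega) (by omega),
      blk_agr h (by omega) (by omega)] at this
  · obtain ⟨a, ha, h⟩ := hy (s.natAbs + t.natAbs + e.natAbs + n + 1)
    have := ha.2 s t e hst hte
    rw [blk_agr h (by omega) (by omega),
      blk_agr h (by omega) (by omega),
      blk_agr h (by omega) (by omega)] at this
    exact this ht

theorem ZC_isShift {X : Set (Config 1)} (hX : IsShift X) {n : ℕ} (hn : 1 ≤ n)
    {C : Set (Fin n → ℤ)} (hne : (ZC X n C).Nonempty) : IsShift (ZC X n C) := by
  obtain ⟨-, ⟨A, hA⟩, -, -⟩ := hX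
  refine ⟨hne, ⟨A, fun y hy v => ?_⟩, ZC_closed, fun u x hx => ZC_shift u hx⟩
  obtain ⟨x, hx, i, h⟩ := wordIn_iff.mp (hy.1 (v 0)).1
  have h0 := congrFun h ⟨0, hn⟩
  have h1 : y v = blk n y (v 0) ⟨0, hn⟩ := by
    conv_lhs => rw [zd_eq v]
    simp [blk]
  rw [h1, ← h0]
  exact hA x hx _

theorem agr_of_blk {R : ℕ} {x y : Config 1} (h : blk (2 * R + 1) y (-R) = blk (2 * R + 1) x (-R)) :
    Agr R 0 x y := by
  intro i hi
  rw [sub_zero, abs_le] at hi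
  have := congrFun h ⟨(i + R).toNat, by omega⟩
  simp only [blk] at this
  rwa [show -(R : ℤ) + ((i + R).toNat : ℤ) = i by omega] at this

theorem ZC_eq {X : Set (Config 1)} (hX : IsShift X) {R : ℕ}
    (hiso : ∀ Z, IsShift Z → deltaH X Z < (1 / 2 : ℝ) ^ R → Z = X)
    {C : Set (Fin (2 * R + 1) → ℤ)}
    (hC : ∀ a b, graphEdge X (2 * R + 1) a b → ∃ z, BiWalk (graphEdge X (2 * R + 1)) z ∧ z 0 = a ∧
      ∀ s t e, s < t → t < e → z t ∈ C → z s ∈ C ∨ z e ∈ C) : ZC X (2 * R + 1) C = X := by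
  have hn : 1 ≤ 2 * R + 1 := by omega
  have key : ∀ x ∈ X, ∃ z ∈ ZC X (2 * R + 1) C, Agr R 0 x z := by
    intro x hx
    obtain ⟨z, hz, hz0, hz2⟩ := hC _ _ (walk_of_mem hx (2 * R + 1) (-R))
    obtain ⟨y, rfl⟩ := of_walk hn hz
    refine ⟨_, ZC_shift (fun _ => (R : ℤ)) ⟨hz, hz2⟩, agr_of_blk ?_⟩
    rw [blk_shift, ← hz0]
    simp
  have hne : (ZC X (2 * R + 1) C).Nonempty := by
    obtain ⟨x, hx⟩ := hX.1
    obtain ⟨z, hz, -⟩ := key x hx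
    exact ⟨z, hz⟩
  refine hiso _ (ZC_isShift hX hn hne) (deltaH_lt hX.1 hne key ?_)
  intro z hz
  obtain ⟨x, hx, i, h⟩ := wordIn_iff.mp (hz.1 (-R)).1
  refine ⟨_, hX.2.2.2 (fun _ => i + R) x hx, agr_of_blk ?_⟩
  rw [blk_shift, ← h]
  simp

theorem edge_ext {X : Set (Config 1)} (hX : IsShift X) {n : ℕ} (a b : Fin n → ℤ)
    (h : graphEdge X n a b) : ∃ x, BiWalk (graphEdge X n) x ∧ x 0 = a ∧ x 1 = b := by
  obtain ⟨x, hx, i, rfl, rfl⟩ := graphEdge_iff.mp h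
  refine ⟨_, walk_of_mem (hX.2.2.2 (fun _ => i) x hx) n, ?_, ?_⟩
  · rw [blk_shift]; simp
  · rw [blk_shift]

theorem no_mid_of_isolated {X : Set (Config 1)} (hX : IsShift X) {R : ℕ}
    (hiso : ∀ Z, IsShift Z → deltaH X Z < (1 / 2 : ℝ) ^ R → Z = X) :
    ¬ Mid (graphEdge X (2 * R + 1)) := by
  rintro ⟨k, hk, c, hc, hck, ⟨p, hp, i, hi, hpi⟩, ⟨q, hq, j, hj, hqj⟩⟩
  obtain ⟨l, hl, hrange, hrec⟩ := loop_walk hk hc hck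
  obtain ⟨i', hi'⟩ := (hrange (c i)).mpr ⟨i, hi, rfl⟩
  obtain ⟨j', hj'⟩ := (hrange (c j)).mpr ⟨j, hj, rfl⟩
  rw [← hi'] at hpi
  rw [← hj'] at hqj
  have h1 : ZC X (2 * R + 1) Set.univ = X := by
    refine ZC_eq hX hiso fun a b hab => ?_
    obtain ⟨x, hx, h0, -⟩ := edge_ext hX a b hab
    exact ⟨x, hx, h0, by simp⟩
  have h2 : ZC X (2 * R + 1) (Set.range l) = X := by
    refine ZC_eq hX hiso fun a b hab => ?_
    obtain ⟨x, hx, h0, -⟩ := edge_ext hX a b hab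
    obtain ⟨z, hz, hz0, -, hz2⟩ := edge_walk hx hl
    exact ⟨z, hz, hz0.trans h0, hz2⟩
  obtain ⟨z, hz, hz0, hz1, m, hm, hzm⟩ := through_walk (edge_ext hX) hl hrec hpi hqj
  obtain ⟨y, rfl⟩ := of_walk (by omega) hz
  have hy : y ∈ ZC X (2 * R + 1) Set.univ := ⟨hz, by simp⟩
  rw [h1, ← h2] at hy
  rcases hy.2 0 1 m (by norm_num) hm (hz1 ▸ ⟨i', rfl⟩) with h | h
  · rw [hz0, hrange] at h
    obtain ⟨r, hr, h⟩ := h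
    exact hp r hr h
  · rw [hzm, hrange] at h
    obtain ⟨r, hr, h⟩ := h
    exact hq r hr h

end NMC

/-- A one-dimensional shift is isolated in `S^1` iff it has the
no-middle-cycle property: some graph `G_{X,n}` contains no middle cycle. -/
theorem isolated_iff_no_middle_cycle
    (X : Set (Config 1)) (hX : IsShift X) :
    IsolatedIn {Y : Set (Config 1) | IsShift Y} X ↔
      ∃ n : ℕ, 1 ≤ n ∧ ¬ HasMiddleCycle X n := by
  constructor
  · rintro ⟨-, ε, hε, h⟩
    obtain ⟨R, hR⟩ := NMC.exists_R hε
    refine ⟨2 * R + 1, by omega, fun hM => ?_⟩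
    exact NMC.no_mid_of_isolated hX (fun Z hZ hd => h Z hZ (hd.trans hR))
      (NMC.hasMiddleCycle_iff.mp hM)
  · rintro ⟨n, hn, hM⟩
    exact NMC.isolated_of_no_mid hX hn (fun h => hM (NMC.hasMiddleCycle_iff.mpr h))
end

section
/- Let X₀ be the two-dimensional shift on the alphabet {0,1,2,3,4,5} (identified with ℤ/6ℤ) consisting of all configurations x : ℤ² → ℤ/6ℤ such that for every u ∈ ℤ² there exist ε₁ ∈ {0,1} and ε₂ ∈ {0,1,2} with x_{u+e₁} = 2·x_u + ε₁ and x_{u+e₂} = 3·x_u + ε₂ (where e₁ = (1,0), e₂ = (0,1), arithmetic in ℤ/6ℤ). Then every subsystem of X₀ different from X₀ itself is finite. -/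
/-- The first standard basis vector of `ℤ²`. -/
def eOne : ZD 2 := fun i => if i = 0 then 1 else 0

/-- The second standard basis vector of `ℤ²`. -/
def eTwo : ZD 2 := fun i => if i = 0 then 0 else 1

/-- The shift `X₀` associated with the `×2 ×3` system: configurations `ℤ² → {0,…,5}`
(identified with `ℤ/6ℤ`) such that `x_{u+e₁} = 2 x_u + ε₁` with `ε₁ ∈ {0,1}` and
`x_{u+e₂} = 3 x_u + ε₂` with `ε₂ ∈ {0,1,2}`, arithmetic in `ℤ/6ℤ`. -/
def XZero : Set (Config 2) :=
  {x | (∀ v : ZD 2, 0 ≤ x v ∧ x v < 6) ∧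
    ∀ u : ZD 2,
      (∃ ε : ZMod 6, (ε = 0 ∨ ε = 1) ∧
        ((x (u + eOne) : ZMod 6) = 2 * (x u : ZMod 6) + ε)) ∧
      (∃ ε : ZMod 6, (ε = 0 ∨ ε = 1 ∨ ε = 2) ∧
        ((x (u + eTwo) : ZMod 6) = 3 * (x u : ZMod 6) + ε))}

open Filter Topology Set

/-- one-step version -/
lemma fur_cover {a b : ℝ} (hb : 0 < b) (hab : b < a) :
    ∃ N : ℝ, ∀ y, N ≤ y → ∃ i j : ℕ, y ≤ i * a + j * b ∧ i * a + j * b < y + (a - b) := by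
  have hc : 0 < a - b := by linarith
  obtain ⟨K, hK⟩ := exists_nat_ge (b / (a - b))
  refine ⟨K * b, fun y hy => ?_⟩
  have hy0 : 0 ≤ y / b := by
    have : 0 ≤ (K:ℝ) * b := by positivity
    exact div_nonneg (this.trans hy) hb.le
  set k := ⌊y / b⌋₊ with hk
  have hKk : K ≤ k := Nat.le_floor ((le_div_iff₀ hb).2 hy)
  have h1 : (k:ℝ) * b ≤ y := (le_div_iff₀ hb).1 (Nat.floor_le hy0)
  have h2 : y < (k + 1) * b := (div_lt_iff₀ hb).1 (Nat.lt_floor_add_one _)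
  set r := y - k * b with hr
  have hr0 : 0 ≤ r := by linarith
  have hrb : r < b := by linarith
  set j := ⌈r / (a - b)⌉₊ with hj
  have hjK : j ≤ K := Nat.ceil_le.2 (le_trans (by gcongr) hK)
  have h3 : r ≤ j * (a - b) := (div_le_iff₀ hc).1 (Nat.le_ceil _)
  have h4 : (j:ℝ) < r / (a - b) + 1 := Nat.ceil_lt_add_one (by positivity)
  have h5 : (j:ℝ) * (a - b) < r + (a - b) := by
    have := mul_lt_mul_of_pos_right h4 hc
    rwa [add_mul, div_mul_cancel₀ _ hc.ne', one_mul] at this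
  refine ⟨j, k - j, ?_, ?_⟩
  · rw [Nat.cast_sub (hjK.trans hKk)]; nlinarith
  · rw [Nat.cast_sub (hjK.trans hKk)]; nlinarith

lemma fur_cover' {a b : ℝ} (ha : 0 < a) (hb : 0 < b)
    (hirr : ∀ m n : ℕ, 0 < m → (m:ℝ) * a ≠ n * b) (ε : ℝ) (hε : 0 < ε) :
    ∃ N : ℝ, ∀ y, N ≤ y → ∃ i j : ℕ, y ≤ i * a + j * b ∧ i * a + j * b < y + ε := by
  obtain ⟨n, hn⟩ := exists_nat_gt (max (b / ε) (b / a))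
  have hn1 : b / ε < n := (le_max_left _ _).trans_lt hn
  have hn2 : b / a < n := (le_max_right _ _).trans_lt hn
  have hn0 : 0 < n := by
    have : (0:ℝ) < n := lt_trans (by positivity) hn1
    exact_mod_cast this
  obtain ⟨j, k, hk0, -, h⟩ := Real.exists_int_int_abs_mul_sub_le (a / b) hn0
  lift k to ℕ using hk0.le
  have hk1 : 1 ≤ (k:ℝ) := by exact_mod_cast hk0
  have hk0' : 0 < k := by exact_mod_cast hk0
  have hnp : (0:ℝ) < n := by exact_mod_cast hn0
  have h' : |(k:ℝ) * a - j * b| < b / n := by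
    have e : (k:ℝ) * a - j * b = ((k:ℤ) * (a / b) - j) * b := by
      field_simp; push_cast; ring
    rw [e, abs_mul, abs_of_pos hb]
    calc _ ≤ 1 / ((n:ℝ) + 1) * b := by gcongr
      _ < 1 / (n:ℝ) * b := by gcongr; linarith
      _ = _ := by ring
  have hnε : b / n < ε := by rw [div_lt_iff₀ hnp]; rw [div_lt_iff₀ hε] at hn1; linarith
  have hna : b / n < a := by rw [div_lt_iff₀ hnp]; rw [div_lt_iff₀ ha] at hn2; linarith
  rw [abs_lt] at h'
  have hj0 : 0 < j := by
    have : 0 < (j:ℝ) * b := by nlinarith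
    have := pos_of_mul_pos_left this hb.le
    exact_mod_cast this
  lift j to ℕ using hj0.le
  have hj0' : (0:ℝ) < (j:ℝ) := by exact_mod_cast hj0
  simp only [Int.cast_natCast] at h'
  rcases lt_or_gt_of_ne (hirr k j hk0') with hlt | hgt
  · obtain ⟨N, hN⟩ := fur_cover (a := j * b) (b := k * a) (by positivity) hlt
    refine ⟨N, fun y hy => ?_⟩
    obtain ⟨p, q, h1, h2⟩ := hN y hy
    refine ⟨q * k, p * j, ?_, ?_⟩ <;> push_cast <;> nlinarith
  · obtain ⟨N, hN⟩ := fur_cover (a := k * a) (b := j * b) (by positivity) hgt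
    refine ⟨N, fun y hy => ?_⟩
    obtain ⟨p, q, h1, h2⟩ := hN y hy
    refine ⟨p * k, q * j, ?_, ?_⟩ <;> push_cast <;> nlinarith

lemma fur_pow_ne (m n : ℕ) (hm : 0 < m) : 2 ^ m ≠ 3 ^ n := by
  intro h
  have h2 : Even (2 ^ m) := (Nat.even_pow.2 ⟨even_two, hm.ne'⟩)
  rw [h] at h2
  exact (Nat.not_even_iff_odd.2 (Odd.pow (by decide))) h2

/-- Nonlacunarity, multiplicative version. -/
lemma fur_nonlac (u : ℕ) (hu : 0 < u) (ε : ℝ) (hε : 0 < ε) :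
    ∃ N : ℝ, 0 < N ∧ ∀ y, N ≤ y → ∃ i j : ℕ,
      y ≤ (((2 ^ u) ^ i * (3 ^ u) ^ j : ℕ) : ℝ) ∧
      (((2 ^ u) ^ i * (3 ^ u) ^ j : ℕ) : ℝ) ≤ (1 + ε) * y := by
  have hup : (0:ℝ) < u := by exact_mod_cast hu
  obtain ⟨N, hN⟩ := fur_cover' (a := u * Real.log 2) (b := u * Real.log 3)
    (mul_pos hup (Real.log_pos (by norm_num))) (mul_pos hup (Real.log_pos (by norm_num)))
    (by
      intro m n hm h
      apply fur_pow_ne m n hm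
      have h1 : (m:ℝ) * Real.log 2 = n * Real.log 3 := by
        apply mul_left_cancel₀ hup.ne'; linarith
      rw [← Real.log_pow, ← Real.log_pow] at h1
      have := Real.log_injOn_pos (by simp) (by simp) h1
      exact_mod_cast this)
    (Real.log (1 + ε)) (Real.log_pos (by linarith))
  refine ⟨Real.exp N, Real.exp_pos _, fun y hy => ?_⟩
  have hy0 : 0 < y := (Real.exp_pos _).trans_le hy
  obtain ⟨i, j, h1, h2⟩ := hN (Real.log y) ((Real.le_log_iff_exp_le hy0).2 hy)
  have e : (i:ℝ) * (u * Real.log 2) + j * (u * Real.log 3) =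
      Real.log (((2 ^ u) ^ i * (3 ^ u) ^ j : ℕ) : ℝ) := by
    push_cast
    rw [Real.log_mul (by positivity) (by positivity)]
    simp only [Real.log_pow]
  rw [e] at h1 h2
  have hs : (0:ℝ) < (((2 ^ u) ^ i * (3 ^ u) ^ j : ℕ) : ℝ) := by positivity
  refine ⟨i, j, (Real.log_le_log_iff hy0 hs).1 h1, ?_⟩
  rw [← Real.log_mul hy0.ne' (by positivity)] at h2
  have := (Real.log_lt_log_iff hs (by positivity)).1 h2
  linarith

lemma fur_inv {A : Set UnitAddCircle} {p q : ℕ} (hp : ∀ x ∈ A, p • x ∈ A)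
    (hq : ∀ x ∈ A, q • x ∈ A) (i j : ℕ) : ∀ x ∈ A, (p ^ i * q ^ j) • x ∈ A := by
  have h1 : ∀ i : ℕ, ∀ x ∈ A, p ^ i • x ∈ A := by
    intro i; induction i with
    | zero => simp
    | succ k ih => intro x hx; rw [pow_succ, mul_smul]; exact ih _ (hp _ hx)
  have h2 : ∀ i : ℕ, ∀ x ∈ A, q ^ i • x ∈ A := by
    intro i; induction i with
    | zero => simp
    | succ k ih => intro x hx; rw [pow_succ, mul_smul]; exact ih _ (hq _ hx)
  intro x hx; rw [mul_smul]; exact h1 _ _ (h2 _ _ hx)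

lemma fur_norm_le (r : ℝ) : ‖(r : UnitAddCircle)‖ ≤ |r| := by
  rw [UnitAddCircle.norm_eq]
  simpa using round_le r 0

lemma fur_lift_small (x : UnitAddCircle) : ∃ r : ℝ, (r : UnitAddCircle) = x ∧ |r| = ‖x‖ := by
  obtain ⟨r, rfl⟩ := QuotientAddGroup.mk_surjective x
  refine ⟨r - round r, ?_, (UnitAddCircle.norm_eq).symm⟩
  have : ((round r : ℝ) : UnitAddCircle) = 0 := by
    rw [AddCircle.coe_eq_zero_iff]; exact ⟨round r, by simp⟩
  rw [AddCircle.coe_sub, this, sub_zero]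

lemma fur_lift_Ico (x : UnitAddCircle) : ∃ r : ℝ, (r : UnitAddCircle) = x ∧ 0 ≤ r ∧ r < 1 := by
  obtain ⟨r, rfl⟩ := QuotientAddGroup.mk_surjective x
  refine ⟨Int.fract r, ?_, Int.fract_nonneg _, Int.fract_lt_one _⟩
  have : ((⌊r⌋ : ℝ) : UnitAddCircle) = 0 := by
    rw [AddCircle.coe_eq_zero_iff]; exact ⟨⌊r⌋, by simp⟩
  rw [Int.fract, AddCircle.coe_sub, this, sub_zero]

lemma fur_lift_one (x : UnitAddCircle) : ∃ r : ℝ, (r : UnitAddCircle) = x ∧ 1 ≤ r ∧ r < 2 := by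
  obtain ⟨r, h, h0, h1⟩ := fur_lift_Ico x
  refine ⟨r + 1, ?_, by linarith, by linarith⟩
  rw [AddCircle.coe_add, h]
  have : ((1:ℝ) : UnitAddCircle) = 0 := by
    rw [AddCircle.coe_eq_zero_iff]; exact ⟨1, by simp⟩
  rw [this, add_zero]

/-- If `0` is an accumulation point then the set is everything. -/
lemma fur_zero_acc {A : Set UnitAddCircle} (hA : IsClosed A) (u : ℕ) (hu : 0 < u)
    (h2 : ∀ x ∈ A, (2 ^ u) • x ∈ A) (h3 : ∀ x ∈ A, (3 ^ u) • x ∈ A)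
    (hacc : ∀ δ : ℝ, 0 < δ → ∃ x ∈ A, x ≠ 0 ∧ ‖x‖ < δ) : A = univ := by
  rw [eq_univ_iff_forall]
  intro z
  rw [← hA.closure_eq, Metric.mem_closure_iff]
  intro ε hε
  obtain ⟨N, hN0, hN⟩ := fur_nonlac u hu (ε / 4) (by linarith)
  obtain ⟨x, hx, hx0, hxN⟩ := hacc (1 / N) (by positivity)
  obtain ⟨r, rfl, hr⟩ := fur_lift_small x
  have hr0 : r ≠ 0 := by rintro rfl; simp at hx0
  have key : ∀ w y : ℝ, 0 < w → w < 1 / N → 1 ≤ y → y < 2 →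
      ∃ i j : ℕ, |y - (((2 ^ u) ^ i * (3 ^ u) ^ j : ℕ) : ℝ) * w| < ε := by
    intro w y hw hwN hy1 hy2
    obtain ⟨i, j, h1, h2⟩ := hN (y / w) (by
      rw [le_div_iff₀ hw]; rw [lt_div_iff₀ hN0] at hwN; linarith)
    refine ⟨i, j, ?_⟩
    set s : ℝ := (((2 ^ u) ^ i * (3 ^ u) ^ j : ℕ) : ℝ)
    rw [div_le_iff₀ hw] at h1
    have h2' : s * w ≤ (1 + ε / 4) * y := by
      have := mul_le_mul_of_nonneg_right h2 hw.le
      rwa [mul_assoc, div_mul_cancel₀ _ hw.ne'] at this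
    rw [abs_lt]; constructor <;> nlinarith
  rw [← hr] at hxN
  rcases lt_or_gt_of_ne hr0 with hneg | hpos
  · obtain ⟨y, hyz, hy1, hy2⟩ := fur_lift_one (-z)
    rw [abs_of_neg hneg] at hxN
    obtain ⟨i, j, hij⟩ := key (-r) y (by linarith) hxN hy1 hy2
    refine ⟨_, fur_inv h2 h3 i j _ hx, ?_⟩
    have hz : z = ((-y : ℝ) : UnitAddCircle) := by rw [AddCircle.coe_neg, hyz, neg_neg]
    rw [dist_eq_norm, hz, ← AddCircle.coe_nsmul, ← AddCircle.coe_sub]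
    refine (fur_norm_le _).trans_lt ?_
    rw [nsmul_eq_mul, ← abs_neg]
    have e : -(-y - (((2 ^ u) ^ i * (3 ^ u) ^ j : ℕ) : ℝ) * r) =
        y - (((2 ^ u) ^ i * (3 ^ u) ^ j : ℕ) : ℝ) * -r := by ring
    rw [e]; exact hij
  · obtain ⟨y, hyz, hy1, hy2⟩ := fur_lift_one z
    rw [abs_of_pos hpos] at hxN
    obtain ⟨i, j, hij⟩ := key r y hpos hxN hy1 hy2
    refine ⟨_, fur_inv h2 h3 i j _ hx, ?_⟩
    rw [dist_eq_norm, ← hyz, ← AddCircle.coe_nsmul, ← AddCircle.coe_sub]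
    refine (fur_norm_le _).trans_lt ?_
    rwa [nsmul_eq_mul]

lemma fur_acc_sub {A : Set UnitAddCircle} {r : UnitAddCircle} (h : AccPt r (𝓟 A)) (δ : ℝ)
    (hδ : 0 < δ) : ∃ x ∈ A, x - r ≠ 0 ∧ ‖x - r‖ < δ := by
  rw [accPt_iff_nhds] at h
  obtain ⟨y, ⟨hy1, hy2⟩, hy3⟩ := h _ (Metric.ball_mem_nhds r hδ)
  exact ⟨y, hy2, sub_ne_zero.2 hy3, by rwa [mem_ball_iff_norm] at hy1⟩

/-- translate of the previous lemma to a fixed accumulation point. -/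
lemma fur_fixed_acc {A : Set UnitAddCircle} (hA : IsClosed A) (u : ℕ) (hu : 0 < u)
    (h2 : ∀ x ∈ A, (2 ^ u) • x ∈ A) (h3 : ∀ x ∈ A, (3 ^ u) • x ∈ A)
    {r : UnitAddCircle} (hr2 : (2 ^ u) • r = r) (hr3 : (3 ^ u) • r = r)
    (h : AccPt r (𝓟 A)) : A = univ := by
  have := fur_zero_acc (A := (fun x => x + r) ⁻¹' A)
    (hA.preimage (by fun_prop)) u hu
    (fun x hx => by
      have := h2 _ hx
      simpa only [mem_preimage, smul_add, hr2] using this)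
    (fun x hx => by
      have := h3 _ hx
      simpa only [mem_preimage, smul_add, hr3] using this)
    (fun δ hδ => by
      obtain ⟨x, hx, hx0, hxδ⟩ := fur_acc_sub h δ hδ
      exact ⟨x - r, by simpa using hx, hx0, hxδ⟩)
  rw [eq_univ_iff_forall] at this ⊢
  intro z
  simpa using this (z - r)

lemma fur_diff {B : Set UnitAddCircle} (hB : IsClosed B) (hne : B.Infinite) (u : ℕ) (hu : 0 < u)
    (h2 : ∀ x ∈ B, (2 ^ u) • x ∈ B) (h3 : ∀ x ∈ B, (3 ^ u) • x ∈ B) (c : UnitAddCircle) :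
    ∃ x ∈ B, x + c ∈ B := by
  have hc : IsCompact ((fun p : UnitAddCircle × UnitAddCircle => p.1 - p.2) '' (B ×ˢ B)) :=
    (hB.isCompact.prod hB.isCompact).image (by fun_prop)
  have := fur_zero_acc hc.isClosed u hu
    (by
      rintro _ ⟨⟨a, b⟩, ⟨ha, hb⟩, rfl⟩
      exact ⟨((2 ^ u) • a, (2 ^ u) • b), ⟨h2 _ ha, h2 _ hb⟩, by simp [smul_sub]⟩)
    (by
      rintro _ ⟨⟨a, b⟩, ⟨ha, hb⟩, rfl⟩
      exact ⟨((3 ^ u) • a, (3 ^ u) • b), ⟨h3 _ ha, h3 _ hb⟩, by simp [smul_sub]⟩)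
    (by
      intro δ hδ
      obtain ⟨r, hr, hacc⟩ := hne.exists_accPt_of_subset_isCompact hB.isCompact Subset.rfl
      obtain ⟨x, hx, hx0, hxδ⟩ := fur_acc_sub hacc δ hδ
      exact ⟨x - r, ⟨(x, r), ⟨hx, hr⟩, rfl⟩, hx0, hxδ⟩)
  have hcm : c ∈ (univ : Set UnitAddCircle) := mem_univ c
  rw [← this] at hcm
  obtain ⟨⟨a, b⟩, ⟨ha, hb⟩, hab⟩ := hcm
  exact ⟨b, hb, by rw [← hab]; simpa using ha⟩

lemma fur_infinite {B : Set UnitAddCircle} (hne : B.Nonempty) (u : ℕ) (hu : 0 < u)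
    (h2 : ∀ x ∈ B, (2 ^ u) • x ∈ B) (htor : ∀ x ∈ B, ∀ n : ℕ, 0 < n → n • x ≠ 0) :
    B.Infinite := by
  obtain ⟨x, hx⟩ := hne
  have hlt : ∀ k l : ℕ, k < l → ((2 ^ u) ^ k) • x ≠ ((2 ^ u) ^ l) • x := by
    intro k l hkl h
    have hp : (2 ^ u) ^ k < (2 ^ u) ^ l :=
      Nat.pow_lt_pow_right (Nat.one_lt_pow hu.ne' (by norm_num)) hkl
    apply htor x hx ((2 ^ u) ^ l - (2 ^ u) ^ k) (by omega)
    have e : ((2 ^ u) ^ l) • x = ((2 ^ u) ^ l - (2 ^ u) ^ k) • x + ((2 ^ u) ^ k) • x := by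
      rw [← add_smul]; congr 1; omega
    rw [← h] at e
    simpa using e.symm
  apply Set.infinite_of_injective_forall_mem (f := fun k : ℕ => ((2 ^ u) ^ k) • x)
  · intro k l h
    rcases lt_trichotomy k l with h' | h' | h'
    · exact absurd h (hlt _ _ h')
    · exact h'
    · exact absurd h.symm (hlt _ _ h')
  · intro k
    simpa using fur_inv h2 h2 k 0 x hx

lemma fur_chain (u : ℕ) (hu : 0 < u) (c : UnitAddCircle) (hc2 : (2 ^ u) • c = c)
    (hc3 : (3 ^ u) • c = c) (k : ℕ) : ∀ B : Set UnitAddCircle, IsClosed B → B.Nonempty →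
    (∀ x ∈ B, (2 ^ u) • x ∈ B) → (∀ x ∈ B, (3 ^ u) • x ∈ B) →
    (∀ x ∈ B, ∀ n : ℕ, 0 < n → n • x ≠ 0) → ∃ x, ∀ j ≤ k, x + j • c ∈ B := by
  induction k with
  | zero =>
    rintro B - ⟨x, hx⟩ - - -
    exact ⟨x, fun j hj => by obtain rfl : j = 0 := by omega
                             simpa using hx⟩
  | succ k ih =>
    intro B hB hne h2 h3 htor
    obtain ⟨y, hy, hyc⟩ := fur_diff hB (fur_infinite hne u hu h2 htor) u hu h2 h3 c
    obtain ⟨x, hx⟩ := ih (B ∩ (fun x => x + c) ⁻¹' B)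
      (hB.inter (hB.preimage (by fun_prop))) ⟨y, hy, hyc⟩
      (fun x hx => ⟨h2 _ hx.1, by
        have := h2 _ hx.2
        simpa only [mem_preimage, smul_add, hc2] using this⟩)
      (fun x hx => ⟨h3 _ hx.1, by
        have := h3 _ hx.2
        simpa only [mem_preimage, smul_add, hc3] using this⟩)
      (fun x hx => htor x hx.1)
    refine ⟨x, fun j hj => ?_⟩
    rcases Nat.lt_or_ge j (k + 1) with h | h
    · exact (hx j (by omega)).1
    · obtain rfl : j = k + 1 := by omega
      have := (hx k le_rfl).2
      simpa only [mem_preimage, add_smul, one_smul, add_assoc] using this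

lemma fur_fix_of_tors (q : ℕ) (p : ℕ) (hpq : Nat.Coprime p q) (r : UnitAddCircle)
    (hr : q • r = 0) : (p ^ q.totient) • r = r := by
  have h := Nat.ModEq.pow_totient hpq
  rcases Nat.eq_zero_or_pos p with rfl | hp
  · have : q = 1 := by simpa using hpq
    subst this; simp at hr; simp [hr]
  have h1 : 1 ≤ p ^ q.totient := Nat.one_le_pow _ _ hp
  obtain ⟨d, hd⟩ := (Nat.modEq_iff_dvd' h1).1 h.symm
  have : p ^ q.totient = d * q + 1 := by rw [mul_comm d q]; omega
  rw [this, add_smul, mul_smul, hr]; simp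

lemma fur_no_tors {B : Set UnitAddCircle} (hB : IsClosed B) (hne : B.Nonempty)
    (h2 : ∀ x ∈ B, 2 • x ∈ B) (h3 : ∀ x ∈ B, 3 • x ∈ B)
    (htor : ∀ x ∈ B, ∀ n : ℕ, 0 < n → n • x ≠ 0) : B = univ := by
  rw [eq_univ_iff_forall]
  intro z
  rw [← hB.closure_eq, Metric.mem_closure_iff]
  intro ε hε
  obtain ⟨k, hk⟩ := exists_nat_gt (1 / ε)
  set t := 6 * k + 1 with ht
  have htk : (k:ℝ) < t := by rw [ht]; push_cast; linarith [(Nat.cast_nonneg k : (0:ℝ) ≤ k)]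
  have ht0 : (0:ℝ) < t := by positivity
  set c : UnitAddCircle := ((1 / t : ℝ) : UnitAddCircle) with hcdef
  have hct : t • c = 0 := by
    rw [hcdef, ← AddCircle.coe_nsmul, nsmul_eq_mul, mul_one_div_cancel ht0.ne',
      AddCircle.coe_eq_zero_iff]
    exact ⟨1, by simp⟩
  have hco2 : Nat.Coprime 2 t := by
    rw [Nat.coprime_two_left]; exact ⟨3 * k, by omega⟩
  have hco3 : Nat.Coprime 3 t := by
    rw [Nat.Prime.coprime_iff_not_dvd Nat.prime_three]; omega
  obtain ⟨x, hx⟩ := fur_chain t.totient (Nat.totient_pos.2 (by omega)) c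
    (fur_fix_of_tors t 2 hco2 c hct) (fur_fix_of_tors t 3 hco3 c hct) t B hB hne
    (fun x hx => by simpa using fur_inv h2 h3 t.totient 0 x hx)
    (fun x hx => by simpa using fur_inv h2 h3 0 t.totient x hx) htor
  obtain ⟨r, hr, hr0, hr1⟩ := fur_lift_Ico (z - x)
  have hfl := Nat.floor_le (a := r * t) (by positivity)
  have hfl' := Nat.lt_floor_add_one (r * t)
  set j := ⌊r * t⌋₊
  refine ⟨x + j • c, hx j ?_, ?_⟩
  · have : (j:ℝ) < t := by nlinarith
    exact_mod_cast this.le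
  · rw [dist_eq_norm, ← sub_sub, ← hr, hcdef, ← AddCircle.coe_nsmul, ← AddCircle.coe_sub]
    refine (fur_norm_le _).trans_lt ?_
    rw [nsmul_eq_mul, mul_one_div]
    have e : r - j / t = (r * t - j) / t := by field_simp
    rw [e, abs_of_nonneg (div_nonneg (by linarith) ht0.le), div_lt_iff₀ ht0]
    rw [div_lt_iff₀ hε] at hk
    nlinarith

lemma fur_acc_inv {A : Set UnitAddCircle} (p : ℕ) (hp0 : 0 < p) (hp : ∀ x ∈ A, p • x ∈ A)
    (x : UnitAddCircle) (hx : AccPt x (𝓟 A)) : AccPt (p • x) (𝓟 A) := by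
  rw [accPt_iff_frequently] at hx ⊢
  have hfin : {y : UnitAddCircle | p • y = 0}.Finite := AddCircle.finite_torsion 1 hp0
  have hfin2 : ((fun y => y - x) ⁻¹' ({y : UnitAddCircle | p • y = 0} \ {0})).Finite :=
    (hfin.subset sdiff_subset).preimage (sub_left_injective.injOn)
  have hev : ∀ᶠ y in 𝓝 x, y ∈ ((fun y => y - x) ⁻¹' ({y : UnitAddCircle | p • y = 0} \ {0}))ᶜ :=
    hfin2.isClosed.isOpen_compl.mem_nhds (by simp)
  have hcont : Tendsto (fun y : UnitAddCircle => p • y) (𝓝 x) (𝓝 (p • x)) :=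
    (continuous_nsmul p).tendsto x
  refine hcont.frequently ((hx.and_eventually hev).mono ?_)
  rintro y ⟨⟨hyx, hyA⟩, hy⟩
  refine ⟨fun h => hy ⟨?_, ?_⟩, hp _ hyA⟩
  · simp [smul_sub, h]
  · simpa [sub_eq_zero] using hyx

/-- Furstenberg's theorem. -/
theorem furstenberg {A : Set UnitAddCircle} (hA : IsClosed A)
    (h2 : ∀ x ∈ A, 2 • x ∈ A) (h3 : ∀ x ∈ A, 3 • x ∈ A) (hinf : A.Infinite) : A = univ := by
  have hsub : derivedSet A ⊆ A := (isClosed_iff_derivedSet_subset A).1 hA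
  have d2 : ∀ x ∈ derivedSet A, 2 • x ∈ derivedSet A := fun x hx =>
    fur_acc_inv 2 (by norm_num) h2 x hx
  have d3 : ∀ x ∈ derivedSet A, 3 • x ∈ derivedSet A := fun x hx =>
    fur_acc_inv 3 (by norm_num) h3 x hx
  by_cases htor : ∀ x ∈ derivedSet A, ∀ n : ℕ, 0 < n → n • x ≠ 0
  · obtain ⟨x, hx⟩ := hinf.exists_accPt_principal
    have := fur_no_tors (isClosed_derivedSet A) ⟨x, hx⟩ d2 d3 htor
    rw [this] at hsub
    exact univ_subset_iff.1 hsub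
  · push Not at htor
    obtain ⟨x, hx, n, hn, hnx⟩ := htor
    obtain ⟨a, m, hm, rfl⟩ := Nat.exists_eq_pow_mul_and_not_dvd hn.ne' 2 (by norm_num)
    have hm0 : m ≠ 0 := by rintro rfl; simp at hm
    obtain ⟨b, q, hq, rfl⟩ := Nat.exists_eq_pow_mul_and_not_dvd hm0 3 (by norm_num)
    have hq0 : q ≠ 0 := by rintro rfl; simp at hq
    have hco3 : Nat.Coprime 3 q := by rwa [Nat.Prime.coprime_iff_not_dvd Nat.prime_three]
    have hco2 : Nat.Coprime 2 q := by
      rw [Nat.Prime.coprime_iff_not_dvd Nat.prime_two]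
      exact fun h => hm (h.mul_left _)
    have hr : q • ((2 ^ a * 3 ^ b) • x) = 0 := by
      rw [← mul_smul, ← hnx]; congr 1; ring
    exact fur_fixed_acc hA q.totient (Nat.totient_pos.2 (by omega))
      (fun x hx => by simpa using fur_inv h2 h3 q.totient 0 x hx)
      (fun x hx => by simpa using fur_inv h2 h3 0 q.totient x hx)
      (fur_fix_of_tors q 2 hco2 _ hr) (fur_fix_of_tors q 3 hco3 _ hr)
      (fur_inv d2 d3 a b x hx)

/-- The point `(p,q)` of `ℤ²`. -/
def zpt (p q : ℤ) : ZD 2 := ![p, q]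

lemma zpt_eOne (p q : ℤ) : zpt p q + eOne = zpt (p + 1) q := by
  ext i; fin_cases i <;> simp [zpt, eOne]

lemma zpt_eTwo (p q : ℤ) : zpt p q + eTwo = zpt p (q + 1) := by
  ext i; fin_cases i <;> simp [zpt, eTwo]

lemma zpt_add (a b c d : ℤ) : zpt a b + zpt c d = zpt (a + c) (b + d) := by
  ext i; fin_cases i <;> simp [zpt]

lemma zpt_self (v : ZD 2) : v = zpt (v 0) (v 1) := by
  ext i; fin_cases i <;> simp [zpt]

lemma zpt_ext {x y : Config 2} (h : ∀ p q, x (zpt p q) = y (zpt p q)) : x = y := by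
  funext v; rw [zpt_self v]; exact h _ _

lemma shift_zpt (x : Config 2) (a b p q : ℤ) :
    shiftMap (zpt a b) x (zpt p q) = x (zpt (a + p) (b + q)) := by
  simp [shiftMap, zpt_add]

lemma XZero_shift (x : Config 2) (hx : x ∈ XZero) (u : ZD 2) : shiftMap u x ∈ XZero := by
  refine ⟨fun v => hx.1 _, fun v => ?_⟩
  have := hx.2 (u + v)
  simpa only [shiftMap, add_assoc] using this

lemma XZero_step1 (x : Config 2) (hx : x ∈ XZero) (p q : ℤ) :
    ∃ e : ℤ, (e = 0 ∨ e = 1) ∧ (x (zpt (p + 1) q)) % 6 = (2 * x (zpt p q) + e) % 6 := by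
  obtain ⟨ε, hε, h⟩ := (hx.2 (zpt p q)).1
  rw [zpt_eOne] at h
  rcases hε with rfl | rfl
  · refine ⟨0, Or.inl rfl, ?_⟩
    apply (ZMod.intCast_eq_intCast_iff' _ _ 6).1; push_cast; exact h
  · refine ⟨1, Or.inr rfl, ?_⟩
    apply (ZMod.intCast_eq_intCast_iff' _ _ 6).1; push_cast; exact h

lemma XZero_step2 (x : Config 2) (hx : x ∈ XZero) (p q : ℤ) :
    ∃ e : ℤ, (e = 0 ∨ e = 1 ∨ e = 2) ∧
      (x (zpt p (q + 1))) % 6 = (3 * x (zpt p q) + e) % 6 := by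
  obtain ⟨ε, hε, h⟩ := (hx.2 (zpt p q)).2
  rw [zpt_eTwo] at h
  rcases hε with rfl | rfl | rfl
  · refine ⟨0, Or.inl rfl, ?_⟩
    apply (ZMod.intCast_eq_intCast_iff' _ _ 6).1; push_cast; exact h
  · refine ⟨1, Or.inr (Or.inl rfl), ?_⟩
    apply (ZMod.intCast_eq_intCast_iff' _ _ 6).1; push_cast; exact h
  · refine ⟨2, Or.inr (Or.inr rfl), ?_⟩
    apply (ZMod.intCast_eq_intCast_iff' _ _ 6).1; push_cast; exact h

lemma XZero_rule1 (x : Config 2) (hx : x ∈ XZero) (p q : ℤ) :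
    x (zpt (p + 1) q) =
      2 * x (zpt p q) + x (zpt (p + 1) (q + 1)) / 3 - 6 * (x (zpt p q) / 3) := by
  obtain ⟨e, he, h⟩ := XZero_step1 x hx p q
  obtain ⟨f, hf, h'⟩ := XZero_step2 x hx (p + 1) q
  have h1 := hx.1 (zpt p q)
  have h2 := hx.1 (zpt (p + 1) q)
  have h3 := hx.1 (zpt (p + 1) (q + 1))
  omega

lemma XZero_rule2 (x : Config 2) (hx : x ∈ XZero) (p q : ℤ) :
    x (zpt p (q + 1)) =
      3 * x (zpt p q) + x (zpt (p + 1) (q + 1)) / 2 - 6 * (x (zpt p q) / 2) := by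
  obtain ⟨e, he, h⟩ := XZero_step2 x hx p q
  obtain ⟨f, hf, h'⟩ := XZero_step1 x hx p (q + 1)
  have h1 := hx.1 (zpt p q)
  have h2 := hx.1 (zpt p (q + 1))
  have h3 := hx.1 (zpt (p + 1) (q + 1))
  omega

/-- A segment of the diagonal determines a triangle on the right. -/
lemma XZero_det1 (x y : Config 2) (hx : x ∈ XZero) (hy : y ∈ XZero) (s : ℤ) (i : ℕ) :
    ∀ L : ℤ, (∀ k, s ≤ k → k ≤ L → x (zpt k k) = y (zpt k k)) →
    ∀ k, s ≤ k → k + i ≤ L → x (zpt (k + i) k) = y (zpt (k + i) k) := by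
  induction i with
  | zero => intro L h k hk hkL; simpa using h k hk (by simpa using hkL)
  | succ i ih =>
    intro L h k hk hkL
    push_cast at hkL ⊢
    rw [← add_assoc, XZero_rule1 x hx, XZero_rule1 y hy, ih L h k hk (by omega)]
    have := ih L h (k + 1) (by omega) (by omega)
    rw [show k + 1 + (i:ℤ) = k + i + 1 by ring] at this
    rw [this]

lemma XZero_det2 (x y : Config 2) (hx : x ∈ XZero) (hy : y ∈ XZero) (s : ℤ) (i : ℕ) :
    ∀ L : ℤ, (∀ k, s ≤ k → k ≤ L → x (zpt k k) = y (zpt k k)) →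
    ∀ k, s ≤ k → k + i ≤ L → x (zpt k (k + i)) = y (zpt k (k + i)) := by
  induction i with
  | zero => intro L h k hk hkL; simpa using h k hk (by simpa using hkL)
  | succ i ih =>
    intro L h k hk hkL
    push_cast at hkL ⊢
    rw [← add_assoc, XZero_rule2 x hx, XZero_rule2 y hy, ih L h k hk (by omega)]
    have := ih L h (k + 1) (by omega) (by omega)
    rw [show k + 1 + (i:ℤ) = k + i + 1 by ring] at this
    rw [this]

lemma XZero_det (x y : Config 2) (hx : x ∈ XZero) (hy : y ∈ XZero) (s L : ℤ)
    (h : ∀ k, s ≤ k → k ≤ L → x (zpt k k) = y (zpt k k)) (p q : ℤ)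
    (hp : s ≤ p) (hq : s ≤ q) (hpL : p ≤ L) (hqL : q ≤ L) : x (zpt p q) = y (zpt p q) := by
  rcases le_total p q with hpq | hpq
  · obtain ⟨i, rfl⟩ := Int.le.dest hpq
    exact XZero_det2 x y hx hy s i L h p hp hqL
  · obtain ⟨i, rfl⟩ := Int.le.dest hpq
    exact XZero_det1 x y hx hy s i L h q hq hpL

/-- The digits of a configuration along the half diagonal. -/
def dig (x : Config 2) (n : ℕ) : Fin 6 := Fin.ofNat 6 (x (zpt n n)).toNat

lemma dig_val (x : Config 2) (hx : x ∈ XZero) (n : ℕ) :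
    (((dig x n : Fin 6) : ℕ) : ℤ) = x (zpt n n) := by
  have := hx.1 (zpt n n)
  simp only [dig, Fin.val_ofNat]
  omega

lemma dig_valR (x : Config 2) (hx : x ∈ XZero) (n : ℕ) :
    (((dig x n : Fin 6) : ℕ) : ℝ) = (x (zpt n n) : ℝ) := by
  rw [← dig_val x hx n]; simp

lemma dig_continuous : Continuous dig := by
  refine continuous_pi fun n => ?_
  exact (continuous_of_discreteTopology (f := fun z : ℤ => Fin.ofNat 6 z.toNat)).comp
    (continuous_apply (zpt n n))

lemma ofDigits_step (d : ℕ → Fin 6) :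
    6 * Real.ofDigits d = ((d 0 : ℕ) : ℝ) + Real.ofDigits (fun n => d (n + 1)) := by
  rw [Real.ofDigits_eq_sum_add_ofDigits d 1]
  simp [Real.ofDigitsTerm]
  ring

/-- The real number attached to a configuration. -/
noncomputable def fval (x : Config 2) : ℝ := Real.ofDigits (dig x)

lemma fval_nonneg (x : Config 2) : 0 ≤ fval x := Real.ofDigits_nonneg _

lemma fval_le_one (x : Config 2) : fval x ≤ 1 := Real.ofDigits_le_one _

lemma fval_continuous : Continuous fval := Real.continuous_ofDigits.comp dig_continuous

lemma fval_step (x : Config 2) (hx : x ∈ XZero) :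
    6 * fval x = x (zpt 0 0) + fval (shiftMap (zpt 1 1) x) := by
  have h := ofDigits_step (dig x)
  rw [dig_valR x hx] at h
  have e : (fun n => dig x (n + 1)) = dig (shiftMap (zpt 1 1) x) := by
    funext n
    simp only [dig, shift_zpt]
    push_cast
    rw [add_comm (1:ℤ)]
  rw [e] at h
  exact_mod_cast h

lemma fval_mul_gen (e : ZD 2) (k : ℤ) (c : ℤ → ℤ) (K : ℝ)
    (hK : ∀ x ∈ XZero, |(c (x (zpt 0 0)) : ℝ)| ≤ K)
    (hrule : ∀ x ∈ XZero, x (e + zpt 0 0) =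
      k * x (zpt 0 0) + c (x (zpt 1 1)) - 6 * c (x (zpt 0 0))) :
    ∀ x ∈ XZero, fval (shiftMap e x) = k * fval x - c (x (zpt 0 0)) := by
  set G : Config 2 → ℝ := fun x => fval (shiftMap e x) - k * fval x + c (x (zpt 0 0)) with hG
  have hstep : ∀ x ∈ XZero, 6 * G x = G (shiftMap (zpt 1 1) x) := by
    intro x hx
    have h1 := fval_step x hx
    have h2 := fval_step (shiftMap e x) (XZero_shift x hx e)
    have h3 : shiftMap (zpt 1 1) (shiftMap e x) = shiftMap e (shiftMap (zpt 1 1) x) := by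
      funext v; simp only [shiftMap]; congr 1; abel
    have h4 : shiftMap (zpt 1 1) x (zpt 0 0) = x (zpt 1 1) := by rw [shift_zpt]; simp
    have h5 : (x (e + zpt 0 0) : ℝ) =
      k * x (zpt 0 0) + c (x (zpt 1 1)) - 6 * c (x (zpt 0 0)) := by exact_mod_cast hrule x hx
    have h6 : shiftMap e x (zpt 0 0) = x (e + zpt 0 0) := rfl
    rw [h3, h6, h5] at h2
    simp only [hG, h4]
    linear_combination h2 - (k:ℝ) * h1
  have hbd : ∀ x ∈ XZero, |G x| ≤ 1 + |(k:ℝ)| + K := by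
    intro x hx
    have a1 := hK x hx
    have a2 : |fval (shiftMap e x)| ≤ 1 := by
      rw [abs_of_nonneg (fval_nonneg _)]; exact fval_le_one _
    have a3 : |(k:ℝ) * fval x| ≤ |(k:ℝ)| := by
      rw [abs_mul, abs_of_nonneg (fval_nonneg x)]
      exact mul_le_of_le_one_right (abs_nonneg _) (fval_le_one _)
    calc |G x| ≤ |fval (shiftMap e x) - k * fval x| + |(c (x (zpt 0 0)) : ℝ)| := abs_add_le _ _
      _ ≤ |fval (shiftMap e x)| + |(k:ℝ) * fval x| + |(c (x (zpt 0 0)) : ℝ)| := by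
        gcongr; exact abs_sub _ _
      _ ≤ _ := by gcongr
  have hpow : ∀ n : ℕ, ∀ x ∈ XZero, 6 ^ n * |G x| ≤ 1 + |(k:ℝ)| + K := by
    intro n
    induction n with
    | zero => intro x hx; simpa using hbd x hx
    | succ n ih =>
      intro x hx
      have := ih _ (XZero_shift x hx (zpt 1 1))
      rw [← hstep x hx, abs_mul] at this
      rw [pow_succ, mul_assoc]
      simpa using this
  intro x hx
  have h0 : G x = 0 := by
    by_contra hne
    have hpos : 0 < |G x| := abs_pos.2 hne
    obtain ⟨n, hn⟩ := pow_unbounded_of_one_lt ((1 + |(k:ℝ)| + K) / |G x|) (by norm_num : (1:ℝ) < 6)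
    rw [div_lt_iff₀ hpos] at hn
    linarith [hpow n x hx]
  simp only [hG] at h0
  linarith

lemma fval_mul2 (x : Config 2) (hx : x ∈ XZero) :
    fval (shiftMap (zpt 1 0) x) = 2 * fval x - ((x (zpt 0 0) / 3 : ℤ) : ℝ) := by
  have := fval_mul_gen (zpt 1 0) 2 (fun z => z / 3) 6
    (by
      intro x hx
      have := hx.1 (zpt 0 0)
      have h : |x (zpt 0 0) / 3| ≤ 6 := by rw [abs_le]; omega
      exact_mod_cast h)
    (by
      intro x hx
      have := XZero_rule1 x hx 0 0
      simpa [zpt_add] using this) x hx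
  simpa using this

lemma fval_mul3 (x : Config 2) (hx : x ∈ XZero) :
    fval (shiftMap (zpt 0 1) x) = 3 * fval x - ((x (zpt 0 0) / 2 : ℤ) : ℝ) := by
  have := fval_mul_gen (zpt 0 1) 3 (fun z => z / 2) 6
    (by
      intro x hx
      have := hx.1 (zpt 0 0)
      have h : |x (zpt 0 0) / 2| ≤ 6 := by rw [abs_le]; omega
      exact_mod_cast h)
    (by
      intro x hx
      have := XZero_rule2 x hx 0 0
      simpa [zpt_add] using this) x hx
  simpa using this

lemma coe_int_circle (n : ℤ) : ((n : ℝ) : UnitAddCircle) = 0 := by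
  rw [AddCircle.coe_eq_zero_iff]; exact ⟨n, by simp⟩

/-- The point of the circle attached to a configuration. -/
noncomputable def cval (x : Config 2) : UnitAddCircle := (fval x : UnitAddCircle)

lemma cval_continuous : Continuous cval :=
  (AddCircle.continuous_mk' 1).comp fval_continuous

lemma cval_mul2 (x : Config 2) (hx : x ∈ XZero) :
    cval (shiftMap (zpt 1 0) x) = 2 • cval x := by
  rw [cval, fval_mul2 x hx, AddCircle.coe_sub, coe_int_circle, sub_zero, cval,
    ← AddCircle.coe_nsmul]
  simp

lemma cval_mul3 (x : Config 2) (hx : x ∈ XZero) :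
    cval (shiftMap (zpt 0 1) x) = 3 • cval x := by
  rw [cval, fval_mul3 x hx, AddCircle.coe_sub, coe_int_circle, sub_zero, cval,
    ← AddCircle.coe_nsmul]
  simp

/-- closedness criterion -/
lemma mem_of_deltaClosed {Z : Set (Config 2)} (hZ : IsDeltaClosed Z) (x : Config 2)
    (h : ∀ m : ℕ, ∃ a ∈ Z, ∀ p q : ℤ, |p| ≤ m → |q| ≤ m → x (zpt p q) = a (zpt p q)) :
    x ∈ Z := by
  apply hZ
  intro ε hε
  obtain ⟨m, hm⟩ := exists_pow_lt_of_lt_one hε (by norm_num : (1/2:ℝ) < 1)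
  obtain ⟨a, ha, hxa⟩ := h m
  refine ⟨a, ha, ?_⟩
  unfold deltaDist
  split_ifs with heq
  · exact hε
  · set S := {k : ℕ | ∃ n : ZD 2, normInf n = k ∧ x n ≠ a n} with hS
    have hne : S.Nonempty := by
      obtain ⟨v, hv⟩ := Function.ne_iff.1 heq
      exact ⟨_, v, rfl, hv⟩
    obtain ⟨n, hn, hxn⟩ := Nat.sInf_mem hne
    have hmS : m ≤ sInf S := by
      by_contra hlt
      push Not at hlt
      rw [← hn] at hlt
      apply hxn
      have h0 : ∀ i, (n i).natAbs ≤ m := fun i =>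
        (Finset.le_sup (f := fun i => (n i).natAbs) (Finset.mem_univ i)).trans hlt.le
      rw [zpt_self n]
      apply hxa
      · have := h0 0; rw [Int.abs_eq_natAbs]; exact_mod_cast this
      · have := h0 1; rw [Int.abs_eq_natAbs]; exact_mod_cast this
    refine lt_of_le_of_lt ?_ hm
    rw [zpow_neg, zpow_natCast, one_div, inv_pow]
    gcongr
    norm_num

lemma isClosed_of_deltaClosed {Z : Set (Config 2)} (hZ : IsDeltaClosed Z) : IsClosed Z := by
  rw [← closure_subset_iff_isClosed]
  intro x hx
  apply mem_of_deltaClosed hZ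
  intro m
  have hopen : IsOpen (⋂ p ∈ Icc (-(m:ℤ)) m, ⋂ q ∈ Icc (-(m:ℤ)) m,
      {a : Config 2 | a (zpt p q) = x (zpt p q)}) := by
    refine (finite_Icc _ _).isOpen_biInter fun p _ => (finite_Icc _ _).isOpen_biInter fun q _ => ?_
    have hcont : Continuous fun a : Config 2 => a (zpt p q) := continuous_apply (zpt p q)
    exact (isOpen_discrete {x (zpt p q)}).preimage hcont
  obtain ⟨a, ha1, ha2⟩ := mem_closure_iff.1 hx _ hopen (by simp)
  refine ⟨a, ha2, fun p q hp hq => ?_⟩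
  simp only [mem_iInter] at ha1
  exact (ha1 p (abs_le.1 hp) q (abs_le.1 hq)).symm

lemma isCompact_of_sub {Z : Set (Config 2)} (hZ : IsDeltaClosed Z) (hsub : Z ⊆ XZero) :
    IsCompact Z := by
  have hc : IsCompact (Set.pi univ fun _ : ZD 2 => Icc (0:ℤ) 5) :=
    isCompact_univ_pi fun _ => (finite_Icc _ _).isCompact
  refine hc.of_isClosed_subset (isClosed_of_deltaClosed hZ) fun x hx v _ => ?_
  have := (hsub hx).1 v
  exact ⟨this.1, by omega⟩

lemma digits_generic (L : ℕ) : ∀ w : ℕ → Fin 6, ∃ t : ℝ, 0 < t ∧ t < 1 ∧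
    ∀ d : ℕ → Fin 6, Real.ofDigits d = t → ∀ n < L, d n = w n := by
  induction L with
  | zero => intro w; exact ⟨1 / 2, by norm_num, by norm_num, fun d _ n hn => by omega⟩
  | succ L ih =>
    intro w
    obtain ⟨t, ht0, ht1, ht⟩ := ih fun n => w (n + 1)
    have hw : ((w 0 : ℕ) : ℝ) ≤ 5 := by
      have : (w 0 : ℕ) ≤ 5 := by have := (w 0).2; omega
      exact_mod_cast this
    have hw0 : (0:ℝ) ≤ ((w 0 : ℕ) : ℝ) := Nat.cast_nonneg _
    refine ⟨(((w 0 : ℕ) : ℝ) + t) / 6, by positivity, by linarith, fun d hd => ?_⟩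
    have h := ofDigits_step d
    have h0 := Real.ofDigits_nonneg fun n => d (n + 1)
    have h1 := Real.ofDigits_le_one fun n => d (n + 1)
    rw [hd] at h
    have e : d 0 = w 0 := by
      apply Fin.ext
      have a1 : ((d 0 : ℕ) : ℝ) < ((w 0 : ℕ) : ℝ) + 1 := by linarith
      have a2 : ((w 0 : ℕ) : ℝ) < ((d 0 : ℕ) : ℝ) + 1 := by linarith
      have b1 : (d 0 : ℕ) < (w 0 : ℕ) + 1 := by exact_mod_cast a1
      have b2 : (w 0 : ℕ) < (d 0 : ℕ) + 1 := by exact_mod_cast a2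
      omega
    have h2 : Real.ofDigits (fun n => d (n + 1)) = t := by rw [e] at h; linarith
    intro n hn
    cases n with
    | zero => exact e
    | succ n => exact ht _ h2 n (by omega)

lemma digits_zero (n : ℕ) : ∀ d : ℕ → Fin 6, Real.ofDigits d = 0 → d n = 0 := by
  induction n with
  | zero =>
    intro d hd
    have h := ofDigits_step d
    have h0 := Real.ofDigits_nonneg fun n => d (n + 1)
    rw [hd] at h
    have a : ((d 0 : ℕ) : ℝ) ≤ 0 := by linarith
    have b : (d 0 : ℕ) ≤ 0 := by exact_mod_cast a
    apply Fin.ext; simpa using b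
  | succ n ih =>
    intro d hd
    have h := ofDigits_step d
    have h0 := Real.ofDigits_nonneg fun n => d (n + 1)
    rw [hd] at h
    have a : (0:ℝ) ≤ ((d 0 : ℕ) : ℝ) := Nat.cast_nonneg _
    exact ih (fun n => d (n + 1)) (by linarith)

lemma digits_one (n : ℕ) : ∀ d : ℕ → Fin 6, Real.ofDigits d = 1 → d n = 5 := by
  induction n with
  | zero =>
    intro d hd
    have h := ofDigits_step d
    have h1 := Real.ofDigits_le_one fun n => d (n + 1)
    rw [hd] at h
    have a : (5:ℝ) ≤ ((d 0 : ℕ) : ℝ) := by linarith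
    have b : 5 ≤ (d 0 : ℕ) := by exact_mod_cast a
    apply Fin.ext
    have := (d 0).2
    show (d 0 : ℕ) = 5
    omega
  | succ n ih =>
    intro d hd
    have h := ofDigits_step d
    have h1 := Real.ofDigits_le_one fun n => d (n + 1)
    rw [hd] at h
    have a : ((d 0 : ℕ) : ℝ) ≤ 5 := by
      have : (d 0 : ℕ) ≤ 5 := by have := (d 0).2; omega
      exact_mod_cast this
    exact ih (fun n => d (n + 1)) (by linarith)

/-- Eventually zero digit sequences. -/
def EvZero (d : ℕ → Fin 6) : Prop := ∃ N, ∀ n ≥ N, d n = 0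

lemma evZero_tail (d : ℕ → Fin 6) : EvZero d ↔ EvZero fun n => d (n + 1) := by
  constructor
  · rintro ⟨N, h⟩; exact ⟨N, fun n hn => h (n + 1) (by omega)⟩
  · rintro ⟨N, h⟩
    refine ⟨N + 1, fun n hn => ?_⟩
    have : d (n - 1 + 1) = 0 := h (n - 1) (by omega)
    rwa [Nat.sub_add_cancel (by omega)] at this

lemma digits_sep (n : ℕ) : ∀ d d' : ℕ → Fin 6, Real.ofDigits d = Real.ofDigits d' →
    d n ≠ d' n → ¬ (EvZero d ↔ EvZero d') := by
  have main : ∀ d d' : ℕ → Fin 6, Real.ofDigits d = Real.ofDigits d' →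
    (d 0 : ℕ) < d' 0 → ¬ (EvZero d ↔ EvZero d') := by
    intro d d' h hlt
    have s := ofDigits_step d
    have s' := ofDigits_step d'
    have h1 := Real.ofDigits_le_one fun n => d (n + 1)
    have h0' := Real.ofDigits_nonneg fun n => d' (n + 1)
    have hlt' : ((d 0 : ℕ) : ℝ) + 1 ≤ ((d' 0 : ℕ) : ℝ) := by exact_mod_cast hlt
    have e1 : Real.ofDigits (fun n => d (n + 1)) = 1 := by linarith
    have e0 : Real.ofDigits (fun n => d' (n + 1)) = 0 := by linarith
    have z' : EvZero d' := (evZero_tail d').2 ⟨0, fun n _ => digits_zero n _ e0⟩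
    have z : ¬ EvZero d := by
      rw [evZero_tail]
      rintro ⟨N, hN⟩
      have : d (N + 1) = 0 := hN N le_rfl
      rw [digits_one N _ e1] at this
      exact absurd this (by decide)
    tauto
  have main' : ∀ d d' : ℕ → Fin 6, Real.ofDigits d = Real.ofDigits d' →
    d 0 ≠ d' 0 → ¬ (EvZero d ↔ EvZero d') := by
    intro d d' h hne
    rcases lt_or_gt_of_ne (fun hh => hne (Fin.ext hh) : (d 0 : ℕ) ≠ d' 0) with hlt | hgt
    · exact main d d' h hlt
    · have := main d' d h.symm hgt; tauto
  induction n with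
  | zero => exact main'
  | succ n ih =>
    intro d d' h hne
    by_cases h00 : d 0 = d' 0
    · rw [evZero_tail d, evZero_tail d']
      refine ih _ _ ?_ hne
      have s := ofDigits_step d
      have s' := ofDigits_step d'
      rw [h, h00] at s
      linarith
    · exact main' d d' h h00

lemma digits_fiber_finite (t : ℝ) : {d : ℕ → Fin 6 | Real.ofDigits d = t}.Finite := by
  refine Set.Finite.of_finite_image (f := EvZero) (Set.toFinite _) ?_
  intro d hd d' hd' h
  by_contra hne
  obtain ⟨n, hn⟩ := Function.ne_iff.1 hne
  exact digits_sep n d d' (hd.trans hd'.symm) hn (by rw [h])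

lemma circle_fiber_finite (z : UnitAddCircle) :
    {r : ℝ | 0 ≤ r ∧ r ≤ 1 ∧ (r : UnitAddCircle) = z}.Finite := by
  obtain ⟨s, hs, hs0, hs1⟩ := fur_lift_Ico z
  refine (Set.toFinite {s, s + 1}).subset ?_
  rintro r ⟨h0, h1, hr⟩
  have : ((r - s : ℝ) : UnitAddCircle) = 0 := by rw [AddCircle.coe_sub, hr, hs, sub_self]
  obtain ⟨n, hn⟩ := (AddCircle.coe_eq_zero_iff 1).1 this
  simp at hn
  have n1 : n < 2 := by
    have : (n:ℝ) < 2 := by linarith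
    exact_mod_cast this
  have n0 : -1 < n := by
    have : (-1:ℝ) < n := by linarith
    exact_mod_cast this
  have : n = 0 ∨ n = 1 := by omega
  rcases this with rfl | rfl
  · left; push_cast at hn; linarith
  · right; simp at hn; simp; linarith

lemma finite_of_sep {α β : Type*} (Z : Set α) (D : Set β) (hD : D.Finite) (f : ℕ → α → β)
    (hf : ∀ k, ∀ x ∈ Z, f k x ∈ D)
    (hsep : ∀ x ∈ Z, ∀ y ∈ Z, x ≠ y → ∀ᶠ k in atTop, f k x ≠ f k y) : Z.Finite := by
  by_contra hinf
  obtain ⟨s, hs, hcard⟩ := Set.Infinite.exists_subset_card_eq hinf (hD.toFinset.card + 1)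
  have hev : ∀ᶠ k in atTop, ∀ x ∈ s, ∀ y ∈ s, x ≠ y → f k x ≠ f k y := by
    rw [Filter.eventually_all_finset]
    intro x hx
    rw [Filter.eventually_all_finset]
    intro y hy
    by_cases hxy : x = y
    · simp [hxy]
    · exact (hsep x (hs hx) y (hs hy) hxy).mono fun k hk _ => hk
  obtain ⟨k, hk⟩ := hev.exists
  have := Finset.card_le_card_of_injOn (s := s) (t := hD.toFinset) (f k)
    (fun x hx => by simpa using hf k x (hs hx))
    (fun x hx y hy hxy => by
      by_contra hne
      exact hk x hx y hy hne hxy)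
  omega

lemma finite_case {Z : Set (Config 2)} (hsub : Z ⊆ XZero)
    (hinv : ∀ u : ZD 2, ∀ z ∈ Z, shiftMap u z ∈ Z) (hfin : (cval '' Z).Finite) : Z.Finite := by
  have h1 : (fval '' Z).Finite := by
    refine (hfin.biUnion fun z _ => circle_fiber_finite z).subset ?_
    rintro _ ⟨x, hx, rfl⟩
    simp only [mem_iUnion]
    exact ⟨cval x, ⟨x, hx, rfl⟩, fval_nonneg x, fval_le_one x, rfl⟩
  have h2 : (dig '' Z).Finite := by
    refine (h1.biUnion fun t _ => digits_fiber_finite t).subset ?_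
    rintro _ ⟨x, hx, rfl⟩
    simp only [mem_iUnion]
    exact ⟨fval x, ⟨x, hx, rfl⟩, rfl⟩
  refine finite_of_sep Z _ h2 (fun k x => dig (shiftMap (zpt (-k) (-k)) x))
    (fun k x hx => ⟨_, hinv _ x hx, rfl⟩) ?_
  intro x hx y hy hne
  have : ∃ p q, x (zpt p q) ≠ y (zpt p q) := by
    by_contra hcon
    push Not at hcon
    exact hne (zpt_ext hcon)
  obtain ⟨p, q, hpq⟩ := this
  filter_upwards [eventually_ge_atTop (p.natAbs + q.natAbs)] with k hk heq
  apply hpq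
  refine XZero_det x y (hsub hx) (hsub hy) (-k) (max p q) ?_ p q (by omega) (by omega)
    (le_max_left _ _) (le_max_right _ _)
  intro j hj _
  have h3 := congrFun heq (j + k).toNat
  have h4 := congrArg (fun a : Fin 6 => ((a : ℕ) : ℤ)) h3
  beta_reduce at h4
  rw [dig_val _ (XZero_shift x (hsub hx) _), dig_val _ (XZero_shift y (hsub hy) _),
    shift_zpt, shift_zpt] at h4
  have e : -(k:ℤ) + ((j + k).toNat : ℤ) = j := by omega
  rwa [e] at h4

lemma full_case {Z : Set (Config 2)} (hsub : Z ⊆ XZero) (hcl : IsDeltaClosed Z)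
    (hinv : ∀ u : ZD 2, ∀ z ∈ Z, shiftMap u z ∈ Z) (hfull : cval '' Z = univ) : Z = XZero := by
  refine Subset.antisymm hsub fun y hy => mem_of_deltaClosed hcl y fun m => ?_
  have hy' := XZero_shift y hy (zpt (-m) (-m))
  obtain ⟨t, ht0, ht1, ht⟩ := digits_generic (2 * m + 1) (dig (shiftMap (zpt (-m) (-m)) y))
  obtain ⟨a, ha, hat⟩ : (t : UnitAddCircle) ∈ cval '' Z := by rw [hfull]; trivial
  have hfa : fval a = t := by
    have : ((fval a - t : ℝ) : UnitAddCircle) = 0 := by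
      rw [AddCircle.coe_sub, ← hat, cval, sub_self]
    obtain ⟨n, hn⟩ := (AddCircle.coe_eq_zero_iff 1).1 this
    simp at hn
    have h0 := fval_nonneg a
    have h1 := fval_le_one a
    have n1 : n < 1 := by
      have : (n:ℝ) < 1 := by linarith
      exact_mod_cast this
    have n0 : -1 < n := by
      have : (-1:ℝ) < n := by linarith
      exact_mod_cast this
    obtain rfl : n = 0 := by omega
    simp at hn; linarith
  have hd := ht (dig a) hfa
  refine ⟨shiftMap (zpt m m) a, hinv _ a ha, fun p q hp hq => ?_⟩
  rw [abs_le] at hp hq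
  refine XZero_det _ _ hy (XZero_shift a (hsub ha) _) (-m) m ?_ p q hp.1 hq.1 hp.2 hq.2
  intro j hj hj'
  have h3 := hd (j + m).toNat (by omega)
  have h4 := congrArg (fun a : Fin 6 => ((a : ℕ) : ℤ)) h3
  beta_reduce at h4
  rw [dig_val _ (hsub ha), dig_val _ hy', shift_zpt] at h4
  have e : -(m:ℤ) + ((j + m).toNat : ℤ) = j := by omega
  have e' : ((j + m).toNat : ℤ) = m + j := by omega
  rw [e, e'] at h4
  rw [shift_zpt, h4]

/-- Every subsystem of `X₀` different from `X₀` itself is finite. -/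
theorem proper_subsystems_of_XZero_finite :
    ∀ Z : Set (Config 2), IsSubsystem Z XZero → Z ≠ XZero → Z.Finite := by
  rintro Z ⟨-, hsub, hcl, hinv⟩ hne
  apply finite_case hsub hinv
  by_contra hinf
  apply hne
  refine full_case hsub hcl hinv (furstenberg ?_ ?_ ?_ hinf)
  · exact ((isCompact_of_sub hcl hsub).image cval_continuous).isClosed
  · rintro _ ⟨x, hx, rfl⟩
    exact ⟨_, hinv (zpt 1 0) x hx, cval_mul2 x (hsub hx)⟩
  · rintro _ ⟨x, hx, rfl⟩
    exact ⟨_, hinv (zpt 0 1) x hx, cval_mul3 x (hsub hx)⟩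
end
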